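/- arXiv:1402.0080 — 2 statements merged into one kernel-verified Lean document; each statement's English description precedes it below -/
import Mathlib

section
/- Let A be a homogeneous set. For every ε > 0 there exists δ > 0 such that for every homogeneous set B with χ(A,B) < δ one has |dim_P A − dim_P B| < ε and |dim_H A − dim_H B| < ε, where dim_H denotes Hausdorff dimension and dim_P packing dimension. -/
open scoped ENNReal

noncomputable section

open Filter MeasureTheory

/-- A compact set `A` is *homogeneous* with respect to the Borel probability measure `μ`
supported on `A` and constants `lam ≥ 1`, `kappa ∈ (0,1)`, `1 < del ≤ Del`. -/
structure IsHomog {X : Type*} [MetricSpace X] [MeasurableSpace X]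
    (A : Set X) (μ : Measure X) (lam kappa del Del : ℝ) : Prop where
  compact : IsCompact A
  diam_pos : 0 < Metric.diam A
  prob : IsProbabilityMeasure μ
  supp_null : μ Aᶜ = 0
  supp_pos : ∀ x ∈ A, ∀ r : ℝ, 0 < r → 0 < μ (Metric.closedBall x r)
  one_le_lam : 1 ≤ lam
  ratio_le : ∀ x₁ ∈ A, ∀ x₂ ∈ A, ∀ r : ℝ, 0 < r → r ≤ Metric.diam A →
    (μ (Metric.closedBall x₁ r)).toReal ≤ lam * (μ (Metric.closedBall x₂ r)).toReal
  kappa_pos : 0 < kappa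
  kappa_lt_one : kappa < 1
  one_lt_del : 1 < del
  del_le_Del : del ≤ Del
  scale_lower : ∀ x ∈ A, ∀ r : ℝ, 0 < r → r ≤ Metric.diam A →
    del * (μ (Metric.closedBall x (kappa * r))).toReal ≤ (μ (Metric.closedBall x r)).toReal
  scale_upper : ∀ x ∈ A, ∀ r : ℝ, 0 < r → r ≤ Metric.diam A →
    (μ (Metric.closedBall x r)).toReal ≤ Del * (μ (Metric.closedBall x (kappa * r))).toReal

/-- `alphaPt μ x r = log μ(B(x,r)) / log r`. -/
def alphaPt {X : Type*} [MetricSpace X] [MeasurableSpace X]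
    (μ : Measure X) (x : X) (r : ℝ) : ℝ :=
  Real.log (μ (Metric.closedBall x r)).toReal / Real.log r

/-- `g ∼ h` : `|h r - g r| = O(1/|log r|)` as `r → 0⁺`. -/
def EquivNearZero (g h : ℝ → ℝ) : Prop :=
  ∃ C : ℝ, 0 < C ∧ ∃ δ : ℝ, 0 < δ ∧ ∀ r : ℝ, 0 < r → r < δ → |h r - g r| ≤ C / |Real.log r|

/-- `g` is a representative of the equivalence class `[α_A(x,·)]` of the homogeneous set `A`. -/
def IsAlphaRep {X : Type*} [MetricSpace X] [MeasurableSpace X]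
    (A : Set X) (μ : Measure X) (g : ℝ → ℝ) : Prop :=
  ∃ x ∈ A, EquivNearZero g (fun r => alphaPt μ x r)

/-- `χ(A,B)` computed from representatives `g` of `[α_A]` and `h` of `[α_B]`. -/
def chiFun (g h : ℝ → ℝ) : ℝ :=
  Filter.limsup (fun r => |Real.log (g r / h r)|) (nhdsWithin (0 : ℝ) (Set.Ioi 0))

/-- `N(A,r)`: the smallest number of closed balls of radius `r` needed to cover `A`. -/
def coverNum {X : Type*} [MetricSpace X] (A : Set X) (r : ℝ) : ℕ :=
  sInf {m : ℕ | ∃ s : Finset X, s.card = m ∧ A ⊆ ⋃ x ∈ s, Metric.closedBall x r}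

/-- Lower box-counting dimension. -/
def lowerBoxDim {X : Type*} [MetricSpace X] (A : Set X) : ℝ :=
  Filter.liminf (fun r : ℝ => Real.log (coverNum A r : ℝ) / (-Real.log r))
    (nhdsWithin (0 : ℝ) (Set.Ioi 0))

/-- Upper box-counting dimension. -/
def upperBoxDim {X : Type*} [MetricSpace X] (A : Set X) : ℝ :=
  Filter.limsup (fun r : ℝ => Real.log (coverNum A r : ℝ) / (-Real.log r))
    (nhdsWithin (0 : ℝ) (Set.Ioi 0))

/-- Radius-based packing premeasure. -/
def packPre {X : Type*} [MetricSpace X] (A : Set X) (s : ℝ) : ℝ≥0∞ :=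
  ⨅ (δ : ℝ) (_ : 0 < δ),
    ⨆ (m : ℕ) (x : Fin m → X) (ρ : Fin m → ℝ) (_ : ∀ i, x i ∈ A)
      (_ : ∀ i, 0 < ρ i ∧ ρ i ≤ δ)
      (_ : ∀ i j, i ≠ j →
        Disjoint (Metric.closedBall (x i) (ρ i)) (Metric.closedBall (x j) (ρ j))),
      ∑ i, ENNReal.ofReal (ρ i ^ s)

/-- Radius-based packing measure. -/
def packMeasure {X : Type*} [MetricSpace X] (A : Set X) (s : ℝ) : ℝ≥0∞ :=
  ⨅ (F : ℕ → Set X) (_ : A ⊆ ⋃ m, F m), ∑' m, packPre (F m) s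

/-- Radius-based packing dimension. -/
def packDim {X : Type*} [MetricSpace X] (A : Set X) : ℝ :=
  sInf {s : ℝ | 0 ≤ s ∧ packMeasure A s = 0}

/-- Distance between two sets, valued in `ℝ≥0∞`. -/
def setDistE {X : Type*} [MetricSpace X] (E F : Set X) : ℝ≥0∞ :=
  ⨅ (a : X) (_ : a ∈ E) (b : X) (_ : b ∈ F), edist a b

/-- Uniformly disconnected set. -/
def UnifDisconn {X : Type*} [MetricSpace X] (A : Set X) : Prop :=
  ∃ C : ℝ, 1 < C ∧ ∃ rstar : ℝ, 0 < rstar ∧ ∀ x ∈ A, ∀ r : ℝ, 0 < r → r < rstar →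
    ∃ E : Set X, E ⊆ A ∧ A ∩ Metric.closedBall x r ⊆ E ∧
      E ⊆ Metric.closedBall x (C * r) ∧ ENNReal.ofReal r < setDistE E (A \ E)

/-- `A` can be bilipschitz embedded into `B`. -/
def BilipEmbed {X Y : Type*} [MetricSpace X] [MetricSpace Y] (A : Set X) (B : Set Y) : Prop :=
  ∃ (f : X → Y) (L : ℝ), 1 ≤ L ∧ Set.MapsTo f A B ∧ Set.InjOn f A ∧
    ∀ x₁ ∈ A, ∀ x₂ ∈ A,
      dist x₁ x₂ / L ≤ dist (f x₁) (f x₂) ∧ dist (f x₁) (f x₂) ≤ L * dist x₁ x₂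

/-- `A` and `B` are bilipschitz equivalent. -/
def BilipEquivSets {X Y : Type*} [MetricSpace X] [MetricSpace Y] (A : Set X) (B : Set Y) :
    Prop :=
  ∃ (f : X → Y) (L : ℝ), 1 ≤ L ∧ Set.BijOn f A B ∧
    ∀ x₁ ∈ A, ∀ x₂ ∈ A,
      dist x₁ x₂ / L ≤ dist (f x₁) (f x₂) ∧ dist (f x₁) (f x₂) ≤ L * dist x₁ x₂

/-- `A` and `B` are quasi-Lipschitz equivalent. -/
def QuasiLipEquiv {X Y : Type*} [MetricSpace X] [MetricSpace Y] (A : Set X) (B : Set Y) : Prop :=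
  ∃ f : X → Y, Set.BijOn f A B ∧
    ∀ ε : ℝ, 0 < ε → ∃ δ : ℝ, 0 < δ ∧ ∀ x₁ ∈ A, ∀ x₂ ∈ A,
      0 < dist x₁ x₂ → dist x₁ x₂ < δ →
      |Real.log (dist (f x₁) (f x₂)) / Real.log (dist x₁ x₂) - 1| < ε

/-- Ahlfors–David `s`-regular set. -/
def IsADRegular {X : Type*} [MetricSpace X] [MeasurableSpace X] (A : Set X) (s : ℝ) : Prop :=
  IsCompact A ∧ 0 < Metric.diam A ∧
    ∃ (μ : Measure X) (c : ℝ), 1 ≤ c ∧ μ Aᶜ = 0 ∧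
      ∀ x ∈ A, ∀ r : ℝ, 0 < r → r ≤ Metric.diam A →
        ENNReal.ofReal (c⁻¹ * r ^ s) ≤ μ (Metric.closedBall x r) ∧
          μ (Metric.closedBall x r) ≤ ENNReal.ofReal (c * r ^ s)

/-- `n₁ ⋯ n_k` (with `0`-based indexing of the sequence `n`). -/
def prodN (n : ℕ → ℕ) (k : ℕ) : ℕ := ∏ i ∈ Finset.range k, n i

/-- `c₁ ⋯ c_k` (with `0`-based indexing of the sequence `c`). -/
def prodC (c : ℕ → ℝ) (k : ℕ) : ℝ := ∏ i ∈ Finset.range k, c i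

/-- Admissible word for the branching sequence `n`. -/
def AdmWord (n : ℕ → ℕ) (w : List ℕ) : Prop := ∀ i : Fin w.length, w.get i < n i.val

/-- A Moran structure on `J ⊆ ℝ^d` with branching numbers `n` and ratios `c`:
`Jw w` is the basic set indexed by the word `w`. -/
structure IsMoranSystem {d : ℕ} (J : Set (EuclideanSpace ℝ (Fin d))) (n : ℕ → ℕ)
    (c : ℕ → ℝ) (Jw : List ℕ → Set (EuclideanSpace ℝ (Fin d))) : Prop where
  compact : IsCompact J
  int_nonempty : (interior J).Nonempty
  two_le_n : ∀ k, 2 ≤ n k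
  c_pos : ∀ k, 0 < c k
  c_lt_one : ∀ k, c k < 1
  c_inf_pos : ∃ c₀ : ℝ, 0 < c₀ ∧ ∀ k, c₀ ≤ c k
  root : Jw [] = J
  subset : ∀ w : List ℕ, AdmWord n w → ∀ i : ℕ, i < n w.length → Jw (w ++ [i]) ⊆ Jw w
  similar : ∀ w : List ℕ, AdmWord n w → ∀ i : ℕ, i < n w.length →
    ∃ S : EuclideanSpace ℝ (Fin d) → EuclideanSpace ℝ (Fin d),
      (∀ x y, dist (S x) (S y) = c w.length * dist x y) ∧ Jw (w ++ [i]) = S '' Jw w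
  disj_int : ∀ w : List ℕ, AdmWord n w → ∀ i : ℕ, i < n w.length → ∀ j : ℕ, j < n w.length →
    i ≠ j → Disjoint (interior (Jw (w ++ [i]))) (interior (Jw (w ++ [j])))

/-- The Moran set determined by the family `Jw`. -/
def moranSet {d : ℕ} (n : ℕ → ℕ) (Jw : List ℕ → Set (EuclideanSpace ℝ (Fin d))) :
    Set (EuclideanSpace ℝ (Fin d)) :=
  ⋂ k : ℕ, ⋃ (w : List ℕ) (_ : w.length = k ∧ AdmWord n w), Jw w

/-- The index `k` such that `(c₁⋯c_k)·D < r ≤ (c₁⋯c_{k-1})·D`. -/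
def levelOf (c : ℕ → ℝ) (D r : ℝ) : ℕ := sInf {k : ℕ | prodC c k * D < r}

/-- `Φ(r) = n₁⋯n_k` whenever `(c₁⋯c_k)·D < r ≤ (c₁⋯c_{k-1})·D`, where `D = |J|`. -/
def Phi (n : ℕ → ℕ) (c : ℕ → ℝ) (D r : ℝ) : ℕ := prodN n (levelOf c D r)

open scoped Topology

section SeparatedNets

variable {X : Type*} [MetricSpace X]

theorem exists_finset_separated_net {F : Set X} (hF : TotallyBounded F) {r : ℝ} (hr : 0 < r) :
    ∃ S : Finset X, (S : Set X) ⊆ F ∧ (∀ x ∈ S, ∀ y ∈ S, x ≠ y → r < dist x y) ∧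
      F ⊆ ⋃ x ∈ S, Metric.closedBall x r := by
  lift r to NNReal using hr.le
  obtain ⟨N, -, hNfin, hN⟩ := Metric.exists_finite_isCover_of_totallyBounded
    (ε := r / 2) (by have : r ≠ 0 := (by exact_mod_cast hr.ne'); positivity) hF
  have hfin : Metric.packingNumber r F ≠ ⊤ := by
    refine ne_top_of_le_ne_top (Set.encard_ne_top_iff.2 hNfin)
      (le_trans ?_ hN.externalCoveringNumber_le_encard)
    simpa [mul_div_cancel₀] using
      Metric.packingNumber_two_mul_le_externalCoveringNumber (r / 2) F
  have hSfin : (Metric.maximalSeparatedSet r F).Finite := by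
    rw [← Set.encard_ne_top_iff, Metric.encard_maximalSeparatedSet hfin]
    exact hfin
  refine ⟨hSfin.toFinset, by simpa using Metric.maximalSeparatedSet_subset, ?_, ?_⟩
  · intro x hx y hy hxy
    have := Metric.isSeparated_maximalSeparatedSet (ε := r) (A := F)
      (by simpa using hx) (by simpa using hy) hxy
    replace this : (r : ℝ≥0∞) < edist x y := this
    rw [edist_nndist] at this
    exact_mod_cast this
  · simpa using (Metric.isCover_maximalSeparatedSet hfin).subset_iUnion_closedBall

theorem disjoint_closedBall_half_of_lt_dist {x y : X} {r : ℝ} (h : r < dist x y) :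
    Disjoint (Metric.closedBall x (r / 2)) (Metric.closedBall y (r / 2)) :=
  Metric.closedBall_disjoint_closedBall (by linarith)

theorem le_packPre {F : Set X} {t : ℝ} {K : ℝ≥0∞}
    (h : ∀ δ : ℝ, 0 < δ → ∃ ρ : ℝ, 0 < ρ ∧ ρ ≤ δ ∧ ∃ S : Finset X, (S : Set X) ⊆ F ∧
      (∀ x ∈ S, ∀ y ∈ S, x ≠ y →
        Disjoint (Metric.closedBall x ρ) (Metric.closedBall y ρ)) ∧
      K ≤ S.card * ENNReal.ofReal (ρ ^ t)) :
    K ≤ packPre F t := by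
  refine le_iInf₂ fun δ hδ => ?_
  obtain ⟨ρ, hρ, hρδ, S, hSF, hdisj, hK⟩ := h δ hδ
  refine hK.trans ?_
  refine le_iSup_of_le S.card <| le_iSup_of_le (fun i => (S.equivFin.symm i : X)) <|
    le_iSup_of_le (fun _ => ρ) <| le_iSup_of_le (fun i => hSF (S.equivFin.symm i).2) <|
    le_iSup_of_le (fun _ => ⟨hρ, hρδ⟩) <| le_iSup_of_le (fun i j hij => ?_) ?_
  · exact hdisj _ (S.equivFin.symm i).2 _ (S.equivFin.symm j).2
      fun h => hij (S.equivFin.symm.injective (Subtype.ext h))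
  · simp

end SeparatedNets

namespace IsHomog

variable {X : Type*} [MetricSpace X] [MeasurableSpace X]
  {A : Set X} {μ : Measure X} {lam kappa del Del s t : ℝ} {x : X}

theorem measureReal_closedBall_pos (hA : IsHomog A μ lam kappa del Del) (hx : x ∈ A)
    {r : ℝ} (hr : 0 < r) : 0 < μ.real (Metric.closedBall x r) := by
  have := hA.prob
  exact ENNReal.toReal_pos (hA.supp_pos x hx r hr).ne' (measure_ne_top _ _)

theorem alphaPt_le_iff (hA : IsHomog A μ lam kappa del Del) (hx : x ∈ A) {r : ℝ}
    (hr0 : 0 < r) (hr1 : r < 1) :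
    alphaPt μ x r ≤ s ↔ r ^ s ≤ μ.real (Metric.closedBall x r) := by
  rw [Real.rpow_le_iff_le_log hr0 (hA.measureReal_closedBall_pos hx hr0),
    ← div_le_iff_of_neg (Real.log_neg hr0 hr1)]
  rfl

theorem le_alphaPt_iff (hA : IsHomog A μ lam kappa del Del) (hx : x ∈ A) {r : ℝ}
    (hr0 : 0 < r) (hr1 : r < 1) :
    s ≤ alphaPt μ x r ↔ μ.real (Metric.closedBall x r) ≤ r ^ s := by
  rw [Real.le_rpow_iff_log_le (hA.measureReal_closedBall_pos hx hr0) hr0,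
    ← le_div_iff_of_neg (Real.log_neg hr0 hr1)]
  rfl

theorem eventually_le_diam (hA : IsHomog A μ lam kappa del Del) :
    ∀ᶠ r in 𝓝[>] (0 : ℝ), r ≤ Metric.diam A :=
  (eventually_le_nhds hA.diam_pos).filter_mono nhdsWithin_le_nhds

variable [BorelSpace X]

theorem measure_eq_one (hA : IsHomog A μ lam kappa del Del) : μ A = 1 := by
  have := hA.prob
  rw [← prob_compl_eq_zero_iff hA.compact.measurableSet]
  exact hA.supp_null

theorem measureReal_closedBall_diam (hA : IsHomog A μ lam kappa del Del) (hx : x ∈ A) :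
    μ.real (Metric.closedBall x (Metric.diam A)) = 1 := by
  have := hA.prob
  refine le_antisymm measureReal_le_one ?_
  have hsub : A ⊆ Metric.closedBall x (Metric.diam A) := fun y hy =>
    Metric.dist_le_diam_of_mem hA.compact.isBounded hy hx
  calc (1 : ℝ) = μ.real A := by simp [Measure.real, hA.measure_eq_one]
    _ ≤ _ := measureReal_mono hsub

/-- Mass distribution principle for homogeneous sets. -/
theorem le_dimH (hA : IsHomog A μ lam kappa del Del) (hx : x ∈ A) (hs : 0 < s)
    (h : ∀ᶠ r in 𝓝[>] (0 : ℝ), μ.real (Metric.closedBall x r) ≤ r ^ s) :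
    ENNReal.ofReal s ≤ dimH A := by
  have := hA.prob
  have hlam : 0 < lam := one_pos.trans_le hA.one_le_lam
  obtain ⟨R, hR, hball⟩ := mem_nhdsGT_iff_exists_Ioo_subset.1
    (h.and hA.eventually_le_diam)
  replace hR : 0 < R := hR
  have hmass : ∀ S : Set X, Metric.ediam S ≤ ENNReal.ofReal (R / 2) →
      (ENNReal.ofReal lam⁻¹ • μ) S ≤ Metric.ediam S ^ s := by
    intro S hS
    rcases (S ∩ A).eq_empty_or_nonempty with hSA | ⟨y, hyS, hyA⟩
    · have : μ S = 0 := measure_mono_null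
        (Set.disjoint_iff_inter_eq_empty.2 hSA).subset_compl_right hA.supp_null
      simp [this]
    have hfin : Metric.ediam S ≠ ⊤ := ne_top_of_le_ne_top ENNReal.ofReal_ne_top hS
    set d := Metric.diam S with hd
    have hdiam : Metric.ediam S = ENNReal.ofReal d := (ENNReal.ofReal_toReal hfin).symm
    have hd0 : 0 ≤ d := Metric.diam_nonneg
    have hdR : d < R := by
      rw [hdiam, ENNReal.ofReal_le_ofReal_iff (by positivity)] at hS
      linarith
    have hr : ∀ᶠ r in 𝓝[>] d, μ S ≤ ENNReal.ofReal (lam * r ^ s) := by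
      filter_upwards [Ioo_mem_nhdsGT hdR] with r hr
      have hr0 : 0 < r := hd0.trans_lt hr.1
      obtain ⟨h1, h2⟩ := hball ⟨hr0, hr.2⟩
      have hsub : S ⊆ Metric.closedBall y r := fun z hz =>
        (Metric.dist_le_diam_of_mem' hfin hz hyS).trans hr.1.le
      calc μ S ≤ μ (Metric.closedBall y r) := measure_mono hsub
        _ = ENNReal.ofReal (μ.real (Metric.closedBall y r)) := by simp
        _ ≤ _ := ENNReal.ofReal_le_ofReal ((hA.ratio_le y hyA x hx r hr0 h2).trans
            (mul_le_mul_of_nonneg_left h1 hlam.le))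
    have hlim : Tendsto (fun r : ℝ => ENNReal.ofReal (lam * r ^ s)) (𝓝[>] d)
        (𝓝 (ENNReal.ofReal (lam * d ^ s))) :=
      ((ENNReal.continuous_ofReal.comp
        (continuous_const.mul (Real.continuous_rpow_const hs.le))).tendsto d).mono_left
        nhdsWithin_le_nhds
    have hμ := ge_of_tendsto hlim hr
    rw [hdiam, ENNReal.ofReal_rpow_of_nonneg hd0 hs.le, Measure.smul_apply, smul_eq_mul]
    calc ENNReal.ofReal lam⁻¹ * μ S
        ≤ ENNReal.ofReal lam⁻¹ * ENNReal.ofReal (lam * d ^ s) := by gcongr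
      _ = ENNReal.ofReal (d ^ s) := by
        rw [← ENNReal.ofReal_mul (by positivity), inv_mul_cancel_left₀ hlam.ne']
  have hle := Measure.le_hausdorffMeasure s (ENNReal.ofReal lam⁻¹ • μ)
    (ENNReal.ofReal (R / 2)) (by simpa using hR) hmass A
  refine le_dimH_of_hausdorffMeasure_ne_zero (d := s.toNNReal) (ne_of_gt ?_)
  rw [Real.coe_toNNReal s hs.le]
  refine lt_of_lt_of_le ?_ hle
  simp [hA.measure_eq_one, hlam]

theorem sum_measureReal_closedBall_le_one (hA : IsHomog A μ lam kappa del Del) {ι : Type*} (S : Finset ι)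
    (c : ι → X) (r : ι → ℝ)
    (hdisj : ∀ i ∈ S, ∀ j ∈ S, i ≠ j →
      Disjoint (Metric.closedBall (c i) (r i)) (Metric.closedBall (c j) (r j))) :
    ∑ i ∈ S, μ.real (Metric.closedBall (c i) (r i)) ≤ 1 := by
  have := hA.prob
  rw [← measureReal_biUnion_finset (fun i hi j hj hij => hdisj i hi j hj hij)
    (fun i _ => Metric.isClosed_closedBall.measurableSet)]
  exact measureReal_le_one

theorem dimH_le (hA : IsHomog A μ lam kappa del Del) (hx : x ∈ A) (hs : 0 ≤ s)
    (h : ∃ᶠ r in 𝓝[>] (0 : ℝ), r ^ s ≤ μ.real (Metric.closedBall x r)) :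
    dimH A ≤ ENNReal.ofReal s := by
  have := hA.prob
  have hlam : 0 < lam := one_pos.trans_le hA.one_le_lam
  obtain ⟨r, hr0, hr⟩ := exists_seq_forall_of_frequently
    (h.and_eventually (eventually_mem_nhdsWithin.and hA.eventually_le_diam))
  have hpos : ∀ n, 0 < r n := fun n => (hr n).2.1
  choose S hSA hsep hcov using fun n => exists_finset_separated_net
    hA.compact.totallyBounded (r := 2 * r n) (by linarith [hpos n])
  have hcard : ∀ n, (S n).card * r n ^ s ≤ lam := by
    intro n
    have hsum := hA.sum_measureReal_closedBall_le_one (S n) id (fun _ => r n) fun y hy z hz hyz => by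
      simpa using disjoint_closedBall_half_of_lt_dist (hsep n y hy z hz hyz)
    have hle : (S n).card • (r n ^ s / lam) ≤
        ∑ y ∈ S n, μ.real (Metric.closedBall (id y) (r n)) := by
      refine Finset.card_nsmul_le_sum _ _ _ fun y hy => ?_
      rw [div_le_iff₀' hlam]
      exact (hr n).1.trans (hA.ratio_le x hx y (hSA n hy) _ (hpos n) (hr n).2.2)
    rw [nsmul_eq_mul, ← mul_div_assoc] at hle
    exact (div_le_one hlam).1 (hle.trans hsum)
  have hdiam : ∀ n (y : X), Metric.ediam (Metric.closedBall y (2 * r n)) ≤ ENNReal.ofReal (4 * r n) := by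
    intro n y
    refine Metric.ediam_le_of_forall_dist_le fun a ha b hb => ?_
    have := dist_triangle_right a b y
    rw [Metric.mem_closedBall] at ha hb
    linarith
  have htend : Tendsto (fun n => ENNReal.ofReal (4 * r n)) atTop (𝓝 0) := by
    have := ENNReal.tendsto_ofReal ((hr0.mono_right nhdsWithin_le_nhds).const_mul 4)
    simpa using this
  have hH := Measure.hausdorffMeasure_le_liminf_sum (ι := fun n => {y // y ∈ S n}) s A
    (fun n => ENNReal.ofReal (4 * r n)) htend
    (fun n y => Metric.closedBall (y : X) (2 * r n))
    (Eventually.of_forall fun n y => hdiam n y)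
    (Eventually.of_forall fun n => (hcov n).trans (by
      simp only [Set.iUnion_subset_iff]
      intro y hy
      exact Set.subset_iUnion (fun y : {y // y ∈ S n} => Metric.closedBall (y : X) (2 * r n))
        ⟨y, hy⟩))
  refine dimH_le_of_hausdorffMeasure_ne_top (d := s.toNNReal) ?_
  rw [Real.coe_toNNReal s hs]
  refine ne_top_of_le_ne_top (b := ENNReal.ofReal (4 ^ s * lam)) ENNReal.ofReal_ne_top
    (hH.trans ?_)
  refine liminf_le_of_le (by isBoundedDefault) fun b hb => ?_
  obtain ⟨n, hn⟩ := hb.exists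
  refine hn.trans ?_
  calc ∑ y : {y // y ∈ S n}, Metric.ediam (Metric.closedBall (y : X) (2 * r n)) ^ s
      ≤ ∑ y : {y // y ∈ S n}, ENNReal.ofReal ((4 * r n) ^ s) := by
        refine Finset.sum_le_sum fun y _ => ?_
        rw [← ENNReal.ofReal_rpow_of_nonneg (by linarith [hpos n]) hs]
        exact ENNReal.rpow_le_rpow (hdiam n y) hs
    _ = ENNReal.ofReal ((S n).card * (4 * r n) ^ s) := by
        rw [ENNReal.ofReal_mul (by positivity)]
        simp
    _ ≤ ENNReal.ofReal (4 ^ s * lam) := by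
        refine ENNReal.ofReal_le_ofReal ?_
        rw [Real.mul_rpow (by norm_num) (hpos n).le, mul_left_comm]
        exact mul_le_mul_of_nonneg_left (hcard n) (by positivity)

theorem packMeasure_eq_zero (hA : IsHomog A μ lam kappa del Del) (hx : x ∈ A) (hst : s < t)
    (h : ∀ᶠ r in 𝓝[>] (0 : ℝ), r ^ s ≤ μ.real (Metric.closedBall x r)) :
    packMeasure A t = 0 := by
  have hlam : 0 < lam := one_pos.trans_le hA.one_le_lam
  suffices hpre : packPre A t = 0 from
    le_antisymm (iInf₂_le_of_le (fun _ => A) (Set.subset_iUnion (fun _ : ℕ => A) 0)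
      (by simp [hpre])) bot_le
  obtain ⟨R, hR, hball⟩ := mem_nhdsGT_iff_exists_Ioo_subset.1
    (h.and hA.eventually_le_diam)
  replace hR : 0 < R := hR
  have hbound : ∀ δ ∈ Set.Ioo 0 R, packPre A t ≤ ENNReal.ofReal (δ ^ (t - s) * lam) := by
    intro δ hδ
    refine iInf₂_le_of_le δ hδ.1 ?_
    refine iSup_le fun m => iSup_le fun c => iSup_le fun ρ => iSup_le fun hc =>
      iSup_le fun hρ => iSup_le fun hdisj => ?_
    rw [← ENNReal.ofReal_sum_of_nonneg fun i _ => Real.rpow_nonneg (hρ i).1.le _]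
    refine ENNReal.ofReal_le_ofReal ?_
    calc ∑ i, ρ i ^ t
        ≤ ∑ i, δ ^ (t - s) * lam * μ.real (Metric.closedBall (c i) (ρ i)) := by
          refine Finset.sum_le_sum fun i _ => ?_
          obtain ⟨h1, h2⟩ := hball ⟨(hρ i).1, (hρ i).2.trans_lt hδ.2⟩
          have h3 := h1.trans (hA.ratio_le x hx (c i) (hc i) _ (hρ i).1 h2)
          calc ρ i ^ t = ρ i ^ (t - s) * ρ i ^ s := by
                rw [← Real.rpow_add (hρ i).1, sub_add_cancel]
            _ ≤ δ ^ (t - s) * (lam * μ.real (Metric.closedBall (c i) (ρ i))) :=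
                mul_le_mul (Real.rpow_le_rpow (hρ i).1.le (hρ i).2 (by linarith)) h3
                  (Real.rpow_nonneg (hρ i).1.le _) (Real.rpow_nonneg hδ.1.le _)
            _ = _ := by ring
      _ ≤ δ ^ (t - s) * lam := by
          rw [← Finset.mul_sum]
          exact mul_le_of_le_one_right
            (mul_nonneg (Real.rpow_nonneg hδ.1.le _) hlam.le)
            (hA.sum_measureReal_closedBall_le_one Finset.univ c ρ fun i _ j _ hij => hdisj i j hij)
  have hlim : Tendsto (fun δ : ℝ => ENNReal.ofReal (δ ^ (t - s) * lam)) (𝓝[>] 0) (𝓝 0) := by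
    have h0 : Tendsto (fun δ : ℝ => ENNReal.ofReal (δ ^ (t - s) * lam)) (𝓝 0)
        (𝓝 (ENNReal.ofReal ((0 : ℝ) ^ (t - s) * lam))) :=
      (ENNReal.continuous_ofReal.comp
        ((Real.continuous_rpow_const (sub_pos.2 hst).le).mul continuous_const)).tendsto 0
    rw [Real.zero_rpow (sub_pos.2 hst).ne', zero_mul, ENNReal.ofReal_zero] at h0
    exact h0.mono_left nhdsWithin_le_nhds
  refine le_antisymm (ge_of_tendsto hlim ?_) bot_le
  filter_upwards [Ioo_mem_nhdsGT hR] with δ hδ using hbound δ hδ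

theorem packMeasure_eq_top (hA : IsHomog A μ lam kappa del Del) (hx : x ∈ A) (hts : t < s)
    (h : ∃ᶠ r in 𝓝[>] (0 : ℝ), μ.real (Metric.closedBall x r) ≤ r ^ s) :
    packMeasure A t = ⊤ := by
  have := hA.prob
  have hlam : 0 < lam := one_pos.trans_le hA.one_le_lam
  refine iInf₂_eq_top.2 fun F hF => ?_
  obtain ⟨m, hm⟩ : ∃ m, μ (closure (F m ∩ A)) ≠ 0 := by
    by_contra! hzero
    have hsub : A ⊆ ⋃ m, closure (F m ∩ A) := fun y hy => by
      obtain ⟨m, hm⟩ := Set.mem_iUnion.1 (hF hy)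
      exact Set.mem_iUnion.2 ⟨m, subset_closure ⟨hm, hy⟩⟩
    have := measure_mono_null hsub (measure_iUnion_null hzero)
    simp [hA.measure_eq_one] at this
  refine ENNReal.tsum_eq_top_of_eq_top ⟨m, ?_⟩
  set c := μ.real (closure (F m ∩ A)) with hc
  have hc0 : 0 < c := ENNReal.toReal_pos hm (measure_ne_top _ _)
  have hlim : Tendsto (fun r : ℝ => c / lam * (1 / 2) ^ t * r ^ (t - s)) (𝓝[>] 0) atTop := by
    refine Tendsto.const_mul_atTop (by positivity) ?_
    exact tendsto_rpow_neg_nhdsGT_zero (sub_neg.2 hts)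
  refine ENNReal.eq_top_of_forall_nnreal_le fun K => le_packPre fun δ hδ => ?_
  obtain ⟨r, hr, hKr, hrA, hr0, hrδ⟩ := (h.and_eventually
    ((hlim.eventually_ge_atTop (K : ℝ)).and (hA.eventually_le_diam.and
      (Ioo_mem_nhdsGT hδ)))).exists
  obtain ⟨S, hSF, hsep, hcov⟩ := exists_finset_separated_net
    (hA.compact.totallyBounded.subset (Set.inter_subset_right (s := F m))) hr0
  refine ⟨r / 2, by linarith, by linarith, S, fun y hy => (hSF hy).1,
    fun y hy z hz hyz => disjoint_closedBall_half_of_lt_dist (hsep y hy z hz hyz), ?_⟩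
  have hcS : c ≤ S.card * (lam * r ^ s) := by
    have hcl : closure (F m ∩ A) ⊆ ⋃ y ∈ S, Metric.closedBall y r :=
      closure_minimal hcov (S.finite_toSet.isClosed_biUnion fun _ _ => Metric.isClosed_closedBall)
    calc c ≤ μ.real (⋃ y ∈ S, Metric.closedBall y r) := measureReal_mono hcl (measure_ne_top _ _)
      _ ≤ ∑ y ∈ S, μ.real (Metric.closedBall y r) := measureReal_biUnion_finset_le _ _
      _ ≤ S.card • (lam * r ^ s) := Finset.sum_le_card_nsmul _ _ _ fun y hy =>
          (hA.ratio_le y (hSF hy).2 x hx r hr0 hrA).trans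
            (mul_le_mul_of_nonneg_left hr hlam.le)
      _ = _ := nsmul_eq_mul _ _
  have hK : (K : ℝ) ≤ S.card * (r / 2) ^ t := by
    refine hKr.trans ?_
    rw [div_eq_mul_one_div r, Real.mul_rpow hr0.le (by norm_num), Real.rpow_sub hr0]
    have hrs := Real.rpow_pos_of_pos hr0 s
    have hrt := Real.rpow_pos_of_pos hr0 t
    have h1 : c / lam / r ^ s ≤ S.card := by
      rw [div_div, div_le_iff₀ (by positivity)]
      exact hcS
    calc c / lam * (1 / 2) ^ t * (r ^ t / r ^ s)
        = c / lam / r ^ s * (r ^ t * (1 / 2) ^ t) := by ring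
      _ ≤ _ := mul_le_mul_of_nonneg_right h1 (by positivity)
  rw [← ENNReal.ofReal_coe_nnreal, ← ENNReal.ofReal_natCast, ← ENNReal.ofReal_mul (by positivity)]
  exact ENNReal.ofReal_le_ofReal hK

theorem measureReal_closedBall_pow_mem_Icc (hA : IsHomog A μ lam kappa del Del) (hx : x ∈ A)
    (n : ℕ) :
    μ.real (Metric.closedBall x (kappa ^ n * Metric.diam A)) ∈
      Set.Icc ((Del ^ n)⁻¹) ((del ^ n)⁻¹) := by
  have hdel : 0 < del := one_pos.trans hA.one_lt_del
  have hDel : 0 < Del := hdel.trans_le hA.del_le_Del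
  induction n with
  | zero => simp [hA.measureReal_closedBall_diam hx]
  | succ n ih =>
    have hr0 : 0 < kappa ^ n * Metric.diam A :=
      mul_pos (pow_pos hA.kappa_pos n) hA.diam_pos
    have hr1 : kappa ^ n * Metric.diam A ≤ Metric.diam A :=
      mul_le_of_le_one_left hA.diam_pos.le (pow_le_one₀ hA.kappa_pos.le hA.kappa_lt_one.le)
    have h1 := hA.scale_lower x hx _ hr0 hr1
    have h2 := hA.scale_upper x hx _ hr0 hr1
    rw [← mul_assoc, ← pow_succ'] at h1 h2
    constructor
    · rw [pow_succ Del, mul_inv, ← div_eq_mul_inv, div_le_iff₀' hDel]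
      exact ih.1.trans h2
    · rw [pow_succ del, mul_inv, ← div_eq_mul_inv, le_div_iff₀' hdel]
      exact h1.trans ih.2

theorem exists_eventually_alphaPt_mem_Icc (hA : IsHomog A μ lam kappa del Del) (hx : x ∈ A) :
    ∃ a b : ℝ, 0 < a ∧ ∀ᶠ r in 𝓝[>] (0 : ℝ), alphaPt μ x r ∈ Set.Icc a b := by
  have := hA.prob
  set D := Metric.diam A with hD
  have hD0 : 0 < D := hA.diam_pos
  have hk : Real.log kappa < 0 := Real.log_neg hA.kappa_pos hA.kappa_lt_one
  have hdel0 : 0 < del := one_pos.trans hA.one_lt_del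
  have hdel : 0 < Real.log del := Real.log_pos hA.one_lt_del
  have hDel0 : 0 < Del := hdel0.trans_le hA.del_le_Del
  have hDel : 0 < Real.log Del := Real.log_pos (hA.one_lt_del.trans_le hA.del_le_Del)
  have hlog : ∀ r, 0 < r → r ≤ D →
      Real.log (μ.real (Metric.closedBall x r)) ≤
        -((Real.log r - Real.log D) / Real.log kappa - 1) * Real.log del ∧
      -((Real.log r - Real.log D) / Real.log kappa + 1) * Real.log Del ≤
        Real.log (μ.real (Metric.closedBall x r)) := by
    intro r hr0 hrD
    obtain ⟨n, hn1, hn2⟩ := exists_nat_pow_near_of_lt_one (div_pos hr0 hD0)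
      ((div_le_one hD0).2 hrD) hA.kappa_pos hA.kappa_lt_one
    have hm := hA.measureReal_closedBall_pos hx hr0
    have hup : μ.real (Metric.closedBall x r) ≤ (del ^ n)⁻¹ :=
      (measureReal_mono (Metric.closedBall_subset_closedBall ((div_le_iff₀ hD0).1 hn2))).trans
        (hA.measureReal_closedBall_pow_mem_Icc hx n).2
    have hlo : (Del ^ (n + 1))⁻¹ ≤ μ.real (Metric.closedBall x r) :=
      (hA.measureReal_closedBall_pow_mem_Icc hx (n + 1)).1.trans
        (measureReal_mono (Metric.closedBall_subset_closedBall ((lt_div_iff₀ hD0).1 hn1).le))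
    have l1 := Real.log_le_log hm hup
    have l2 := Real.log_le_log (by positivity) hlo
    have l3 := Real.log_lt_log (pow_pos hA.kappa_pos _) hn1
    have l4 := Real.log_le_log (div_pos hr0 hD0) hn2
    rw [Real.log_inv, Real.log_pow] at l1 l2
    rw [Real.log_pow, Real.log_div hr0.ne' hD0.ne'] at l3 l4
    rw [← div_lt_iff_of_neg hk] at l3
    rw [← le_div_iff_of_neg hk] at l4
    push_cast at l2 l3
    constructor <;> nlinarith
  set a := Real.log del / -Real.log kappa with ha
  set b := Real.log Del / -Real.log kappa with hb
  have ha0 : 0 < a := div_pos hdel (neg_pos.2 hk)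
  have e1 : ∀ᶠ r in 𝓝[>] (0 : ℝ), Real.log r ≤ -(2 / a) * (Real.log del - a * Real.log D) :=
    Real.tendsto_log_nhdsGT_zero.eventually_le_atBot _
  have e2 : ∀ᶠ r in 𝓝[>] (0 : ℝ), Real.log r ≤ -(b * Real.log D) - Real.log Del :=
    Real.tendsto_log_nhdsGT_zero.eventually_le_atBot _
  refine ⟨a / 2, b + 1, half_pos ha0, ?_⟩
  filter_upwards [Ioo_mem_nhdsGT one_pos, hA.eventually_le_diam, e1, e2] with r hr hrD h1 h2
  obtain ⟨hup, hlo⟩ := hlog r hr.1 hrD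
  have hneg := Real.log_neg hr.1 hr.2
  have hup' : -((Real.log r - Real.log D) / Real.log kappa - 1) * Real.log del =
      a * (Real.log r - Real.log D) + Real.log del := by
    rw [ha]; field_simp; ring
  have hlo' : -((Real.log r - Real.log D) / Real.log kappa + 1) * Real.log Del =
      b * (Real.log r - Real.log D) - Real.log Del := by
    rw [hb]; field_simp; ring
  have h1' : a / 2 * Real.log r ≤ -(Real.log del - a * Real.log D) := by
    calc a / 2 * Real.log r ≤ a / 2 * (-(2 / a) * (Real.log del - a * Real.log D)) := by gcongr
      _ = _ := by field_simp
  constructor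
  · change _ ≤ Real.log (μ.real (Metric.closedBall x r)) / Real.log r
    rw [le_div_iff_of_neg hneg]
    linarith
  · change Real.log (μ.real (Metric.closedBall x r)) / Real.log r ≤ _
    rw [div_le_iff_of_neg hneg]
    linarith

end IsHomog

theorem EquivNearZero.tendsto_sub {g h : ℝ → ℝ} (hgh : EquivNearZero g h) :
    Tendsto (fun r => h r - g r) (𝓝[>] 0) (𝓝 0) := by
  obtain ⟨C, -, δ, hδ, hC⟩ := hgh
  refine squeeze_zero_norm' (a := fun r => C / |Real.log r|) ?_ ?_
  · filter_upwards [Ioo_mem_nhdsGT hδ] with r hr using hC r hr.1 hr.2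
  · exact (tendsto_abs_atBot_atTop.comp Real.tendsto_log_nhdsGT_zero).const_div_atTop C

namespace IsAlphaRep

variable {X : Type*} [MetricSpace X] [MeasurableSpace X] [BorelSpace X]
  {A : Set X} {μ : Measure X} {lam kappa del Del c : ℝ} {g : ℝ → ℝ}

theorem exists_eventually_mem_Icc (hg : IsAlphaRep A μ g) (hA : IsHomog A μ lam kappa del Del) :
    ∃ a b : ℝ, 0 < a ∧ ∀ᶠ r in 𝓝[>] (0 : ℝ), g r ∈ Set.Icc a b := by
  obtain ⟨x, hx, hgx⟩ := hg
  obtain ⟨a, b, ha, hab⟩ := hA.exists_eventually_alphaPt_mem_Icc hx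
  refine ⟨a / 2, b + a / 2, half_pos ha, ?_⟩
  filter_upwards [hab, hgx.tendsto_sub.eventually (Ioo_mem_nhds (neg_lt_zero.2 (half_pos ha))
    (half_pos ha))] with r h1 h2
  exact ⟨by linarith [h1.1, h2.2], by linarith [h1.2, h2.1]⟩

theorem packMeasure_eq_zero (hg : IsAlphaRep A μ g) (hA : IsHomog A μ lam kappa del Del)
    (h : ∀ᶠ r in 𝓝[>] (0 : ℝ), g r ≤ c) {t : ℝ} (hct : c < t) : packMeasure A t = 0 := by
  obtain ⟨x, hx, hgx⟩ := hg
  refine hA.packMeasure_eq_zero hx (s := (c + t) / 2) (by linarith) ?_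
  filter_upwards [h, Ioo_mem_nhdsGT one_pos,
    hgx.tendsto_sub.eventually (gt_mem_nhds (half_pos (sub_pos.2 hct)))] with r h1 h2 h3
  exact (hA.alphaPt_le_iff hx h2.1 h2.2).1 (by linarith)

theorem packMeasure_eq_top (hg : IsAlphaRep A μ g) (hA : IsHomog A μ lam kappa del Del)
    (h : ∃ᶠ r in 𝓝[>] (0 : ℝ), c ≤ g r) {t : ℝ} (htc : t < c) : packMeasure A t = ⊤ := by
  obtain ⟨x, hx, hgx⟩ := hg
  refine hA.packMeasure_eq_top hx (s := (c + t) / 2) (by linarith) ?_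
  refine (h.and_eventually ((eventually_mem_set.2 (Ioo_mem_nhdsGT one_pos)).and
    (hgx.tendsto_sub.eventually
      (lt_mem_nhds (neg_lt_zero.2 (half_pos (sub_pos.2 htc))))))).mono ?_
  rintro r ⟨h1, h2, h3⟩
  exact (hA.le_alphaPt_iff hx h2.1 h2.2).1 (by linarith)

theorem packDim_le (hg : IsAlphaRep A μ g) (hA : IsHomog A μ lam kappa del Del)
    (h : ∀ᶠ r in 𝓝[>] (0 : ℝ), g r ≤ c) : packDim A ≤ c := by
  obtain ⟨a, b, ha, hab⟩ := hg.exists_eventually_mem_Icc hA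
  obtain ⟨r, h1, h2⟩ := (h.and hab).exists
  refine le_of_forall_gt_imp_ge_of_dense fun t hct => csInf_le ⟨0, fun s hs => hs.1⟩
    ⟨?_, hg.packMeasure_eq_zero hA h hct⟩
  linarith [h2.1]

theorem le_packDim (hg : IsAlphaRep A μ g) (hA : IsHomog A μ lam kappa del Del)
    (h : ∃ᶠ r in 𝓝[>] (0 : ℝ), c ≤ g r) : c ≤ packDim A := by
  obtain ⟨a, b, ha, hab⟩ := hg.exists_eventually_mem_Icc hA
  refine le_csInf ⟨b + 1, ?_, hg.packMeasure_eq_zero hA (hab.mono fun _ h => h.2)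
    (lt_add_one b)⟩ fun t ht => ?_
  · obtain ⟨r, hr⟩ := hab.exists
    linarith [hr.1.trans hr.2]
  · by_contra! htc
    simpa [ht.2] using hg.packMeasure_eq_top hA h htc

theorem dimH_le (hg : IsAlphaRep A μ g) (hA : IsHomog A μ lam kappa del Del)
    (h : ∃ᶠ r in 𝓝[>] (0 : ℝ), g r ≤ c) : dimH A ≤ ENNReal.ofReal c := by
  obtain ⟨a, b, ha, hab⟩ := hg.exists_eventually_mem_Icc hA
  obtain ⟨r, h1, h2⟩ := (h.and_eventually hab).exists
  have hc : 0 < c := by linarith [h2.1]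
  obtain ⟨x, hx, hgx⟩ := hg
  have hlim : Tendsto ENNReal.ofReal (𝓝[>] c) (𝓝 (ENNReal.ofReal c)) :=
    (ENNReal.continuous_ofReal.tendsto c).mono_left nhdsWithin_le_nhds
  refine ge_of_tendsto hlim ?_
  filter_upwards [self_mem_nhdsWithin] with s (hs : c < s)
  refine hA.dimH_le hx (hc.trans hs).le ((h.and_eventually
    ((eventually_mem_set.2 (Ioo_mem_nhdsGT one_pos)).and
      (hgx.tendsto_sub.eventually (gt_mem_nhds (sub_pos.2 hs))))).mono ?_)
  rintro r ⟨h1, h2, h3⟩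
  exact (hA.alphaPt_le_iff hx h2.1 h2.2).1 (by linarith)

theorem le_dimH (hg : IsAlphaRep A μ g) (hA : IsHomog A μ lam kappa del Del)
    (h : ∀ᶠ r in 𝓝[>] (0 : ℝ), c ≤ g r) : ENNReal.ofReal c ≤ dimH A := by
  rcases le_or_gt c 0 with hc | hc
  · simp [ENNReal.ofReal_of_nonpos hc]
  obtain ⟨x, hx, hgx⟩ := hg
  have hlim : Tendsto ENNReal.ofReal (𝓝[<] c) (𝓝 (ENNReal.ofReal c)) :=
    (ENNReal.continuous_ofReal.tendsto c).mono_left nhdsWithin_le_nhds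
  refine le_of_tendsto hlim ?_
  filter_upwards [Ioo_mem_nhdsLT hc] with s hs
  refine hA.le_dimH hx hs.1 ?_
  filter_upwards [h, Ioo_mem_nhdsGT one_pos,
    hgx.tendsto_sub.eventually (lt_mem_nhds (neg_lt_zero.2 (sub_pos.2 hs.2)))] with r h1 h2 h3
  exact (hA.le_alphaPt_iff hx h2.1 h2.2).1 (by linarith)

theorem dimH_ne_top (hg : IsAlphaRep A μ g) (hA : IsHomog A μ lam kappa del Del) :
    dimH A ≠ ⊤ := by
  obtain ⟨a, b, -, hab⟩ := hg.exists_eventually_mem_Icc hA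
  exact ne_top_of_le_ne_top ENNReal.ofReal_ne_top
    (hg.dimH_le hA (hab.mono fun _ h => h.2).frequently)

variable {Y : Type*} [MetricSpace Y] [MeasurableSpace Y] [BorelSpace Y]
  {B : Set Y} {ν : Measure Y} {lam' kappa' del' Del' K : ℝ} {h : ℝ → ℝ}

theorem packDim_le_mul (hg : IsAlphaRep A μ g) (hA : IsHomog A μ lam kappa del Del)
    (hh : IsAlphaRep B ν h) (hB : IsHomog B ν lam' kappa' del' Del') (hK : 0 < K)
    (hle : ∀ᶠ r in 𝓝[>] (0 : ℝ), h r ≤ K * g r) : packDim B ≤ K * packDim A := by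
  rw [← div_le_iff₀' hK]
  refine le_of_forall_gt_imp_ge_of_dense fun c hc => ?_
  have hlt : ∀ᶠ r in 𝓝[>] (0 : ℝ), g r < c := by
    by_contra hfreq
    rw [not_eventually] at hfreq
    exact hc.not_ge (hg.le_packDim hA (hfreq.mono fun _ => le_of_not_gt))
  rw [div_le_iff₀' hK]
  refine hh.packDim_le hB ?_
  filter_upwards [hle, hlt] with r h1 h2
  exact h1.trans (mul_le_mul_of_nonneg_left h2.le hK.le)

theorem dimH_le_mul (hg : IsAlphaRep A μ g) (hA : IsHomog A μ lam kappa del Del)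
    (hh : IsAlphaRep B ν h) (hB : IsHomog B ν lam' kappa' del' Del') (hK : 0 < K)
    (hle : ∀ᶠ r in 𝓝[>] (0 : ℝ), h r ≤ K * g r) :
    (dimH B).toReal ≤ K * (dimH A).toReal := by
  rw [← div_le_iff₀' hK]
  refine le_of_forall_gt_imp_ge_of_dense fun c hc => ?_
  have hc0 : 0 < c := ENNReal.toReal_nonneg.trans_lt hc
  have hlt : ∃ᶠ r in 𝓝[>] (0 : ℝ), g r < c := by
    by_contra hev
    rw [not_frequently] at hev
    refine hc.not_ge ?_
    rw [← ENNReal.ofReal_le_iff_le_toReal (hg.dimH_ne_top hA)]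
    exact hg.le_dimH hA (hev.mono fun _ => le_of_not_gt)
  rw [div_le_iff₀' hK]
  refine ENNReal.toReal_le_of_le_ofReal (by positivity) (hh.dimH_le hB ?_)
  refine (hlt.and_eventually hle).mono fun r hr => ?_
  exact hr.2.trans (mul_le_mul_of_nonneg_left hr.1.le hK.le)

theorem eventually_le_mul_of_chiFun_lt (hg : IsAlphaRep A μ g)
    (hA : IsHomog A μ lam kappa del Del) (hh : IsAlphaRep B ν h)
    (hB : IsHomog B ν lam' kappa' del' Del') (hK : 0 < K) (hchi : chiFun g h < Real.log K) :
    ∀ᶠ r in 𝓝[>] (0 : ℝ), g r ≤ K * h r ∧ h r ≤ K * g r := by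
  obtain ⟨a, b, ha, hab⟩ := hg.exists_eventually_mem_Icc hA
  obtain ⟨a', b', ha', hab'⟩ := hh.exists_eventually_mem_Icc hB
  have hbdd : IsBoundedUnder (· ≤ ·) (𝓝[>] (0 : ℝ)) fun r => |Real.log (g r / h r)| := by
    refine isBoundedUnder_of_eventually_le
      (a := max (Real.log b - Real.log a') (Real.log b' - Real.log a)) ?_
    filter_upwards [hab, hab'] with r h1 h2
    have hg0 := ha.trans_le h1.1
    have hh0 := ha'.trans_le h2.1
    rw [Real.log_div hg0.ne' hh0.ne']
    have l1 := Real.log_le_log ha h1.1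
    have l2 := Real.log_le_log hg0 h1.2
    have l3 := Real.log_le_log ha' h2.1
    have l4 := Real.log_le_log hh0 h2.2
    exact abs_le.2 ⟨by linarith [le_max_right (Real.log b - Real.log a') (Real.log b' - Real.log a)],
      le_max_of_le_left (by linarith)⟩
  filter_upwards [eventually_lt_of_limsup_lt hchi hbdd, hab, hab'] with r hr h1 h2
  have hg0 := ha.trans_le h1.1
  have hh0 := ha'.trans_le h2.1
  rw [Real.log_div hg0.ne' hh0.ne', abs_lt] at hr
  constructor
  · rw [← Real.log_le_log_iff hg0 (by positivity), Real.log_mul hK.ne' hh0.ne']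
    linarith
  · rw [← Real.log_le_log_iff hh0 (by positivity), Real.log_mul hK.ne' hg0.ne']
    linarith

end IsAlphaRep

theorem packDim_nonneg {X : Type*} [MetricSpace X] (A : Set X) : 0 ≤ packDim A :=
  Real.sInf_nonneg fun _ hs => hs.1

theorem abs_sub_lt_of_le_mul {p q M ε : ℝ} (hε : 0 < ε) (hp : 0 ≤ p) (hpM : p ≤ M)
    (h1 : p ≤ (1 + ε / (M + 1)) * q) (h2 : q ≤ (1 + ε / (M + 1)) * p) : |p - q| < ε := by
  have hM : 0 < M + 1 := by linarith
  have hη : 0 < ε / (M + 1) := div_pos hε hM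
  have hηp : ε / (M + 1) * p < ε := by
    rw [div_mul_eq_mul_div, div_lt_iff₀ hM]
    nlinarith
  rw [abs_sub_lt_iff]
  constructor
  · rcases le_or_gt p q with hpq | hpq
    · linarith
    · nlinarith
  · linarith

/-- For a homogeneous set `A` and any `ε > 0` there is `δ > 0` such that every homogeneous
set `B` with `χ(A,B) < δ` satisfies `|dim_P A − dim_P B| < ε` and `|dim_H A − dim_H B| < ε`. -/
theorem statement9 {X : Type*} [MetricSpace X] [MeasurableSpace X] [BorelSpace X]
    (A : Set X) (μ : Measure X) (lam kappa del Del : ℝ)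
    (hA : IsHomog A μ lam kappa del Del) :
    ∀ ε : ℝ, 0 < ε → ∃ δ : ℝ, 0 < δ ∧
      ∀ (Y : Type*) [MetricSpace Y] [MeasurableSpace Y] [BorelSpace Y]
        (B : Set Y) (ν : Measure Y) (lam' kappa' del' Del' : ℝ),
        IsHomog B ν lam' kappa' del' Del' →
        (∃ gA gB : ℝ → ℝ, IsAlphaRep A μ gA ∧ IsAlphaRep B ν gB ∧ chiFun gA gB < δ) →
        |packDim A - packDim B| < ε ∧ |(dimH A).toReal - (dimH B).toReal| < ε := by
  intro ε hε
  set M := packDim A + (dimH A).toReal with hM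
  have hp : 0 ≤ packDim A := packDim_nonneg A
  have hd : 0 ≤ (dimH A).toReal := ENNReal.toReal_nonneg
  have hη : 0 < ε / (M + 1) := by positivity
  refine ⟨Real.log (1 + ε / (M + 1)), Real.log_pos (by linarith), ?_⟩
  rintro Y _ _ _ B ν lam' kappa' del' Del' hB ⟨g, h, hg, hh, hchi⟩
  have hK : 0 < 1 + ε / (M + 1) := by linarith
  have hev := hg.eventually_le_mul_of_chiFun_lt hA hh hB hK hchi
  have hgh := hev.mono fun _ h => h.1
  have hhg := hev.mono fun _ h => h.2
  exact ⟨abs_sub_lt_of_le_mul hε hp (by linarith) (hh.packDim_le_mul hB hg hA hK hgh)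
      (hg.packDim_le_mul hA hh hB hK hhg),
    abs_sub_lt_of_le_mul hε hd (by linarith) (hh.dimH_le_mul hB hg hA hK hgh)
      (hg.dimH_le_mul hA hh hB hK hhg)⟩

end
end

section
/- Let A be a homogeneous subset of a metric space. For every ε > 0 there exist a Moran set E in some Euclidean space ℝ^d (with inf of the ratio sequence positive) and a bilipschitz map f from E into A such that d_H(f(E), A) < ε and χ(E, A) = χ(f(E), A) < ε, where d_H denotes the Hausdorff distance. -/
open scoped ENNReal

noncomputable section

open Filter MeasureTheory

section Coding

/-- Infinite sequences whose `k`-th letter lies in `{0, …, n k - 1}`. -/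
abbrev SeqSpace (n : ℕ → ℕ) : Type := ∀ k, Fin (n k)

/-- The uniform product measure on the sequence space. -/
def seqMeasure (n : ℕ → ℕ) [∀ k, NeZero (n k)] : Measure (SeqSpace n) :=
  Measure.infinitePi fun _ => ProbabilityTheory.uniformOn Set.univ

/-- The cylinder of sequences that agree with `ω` in the first `k` letters. -/
def seqCyl {n : ℕ → ℕ} (ω : SeqSpace n) (k : ℕ) : Set (SeqSpace n) :=
  {η | ∀ i < k, η i = ω i}

instance {n : ℕ → ℕ} [∀ k, NeZero (n k)] : IsProbabilityMeasure (seqMeasure n) := by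
  unfold seqMeasure; infer_instance

lemma seqMeasure_cyl {n : ℕ → ℕ} [∀ k, NeZero (n k)] (ω : SeqSpace n) (k : ℕ) :
    seqMeasure n (seqCyl ω k) = ((prodN n k : ℕ) : ℝ≥0∞)⁻¹ := by
  have h : seqCyl ω k = Set.pi (Finset.range k : Set ℕ) fun i => {ω i} := by
    ext η; simp [seqCyl, Set.mem_pi]
  rw [h, seqMeasure, Measure.infinitePi_pi _ (fun i _ => measurableSet_singleton _)]
  simp only [ProbabilityTheory.uniformOn_univ, Measure.count_singleton, Fintype.card_fin,
    one_div, prodN, Nat.cast_prod]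
  exact (ENNReal.prod_inv_distrib fun i _ j _ _ => Or.inl (by simpa using NeZero.ne (n i))).symm

lemma seqMeasure_cyl_toReal {n : ℕ → ℕ} [∀ k, NeZero (n k)] (ω : SeqSpace n) (k : ℕ) :
    (seqMeasure n (seqCyl ω k)).toReal = ((prodN n k : ℕ) : ℝ)⁻¹ := by
  simp [seqMeasure_cyl]

lemma eventually_mem_seqCyl {n : ℕ → ℕ} (ω : SeqSpace n) (k : ℕ) :
    ∀ᶠ η in nhds ω, η ∈ seqCyl ω k := by
  have : ∀ i ∈ Set.Iio k, ∀ᶠ η in nhds ω, η i = ω i := fun i _ =>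
    (continuous_apply i).continuousAt.eventually (isOpen_discrete {ω i} |>.mem_nhds rfl)
  exact ((Set.finite_Iio k).eventually_all.2 this)

lemma exists_mem_seqCyl_ne {n : ℕ → ℕ} {ω η : SeqSpace n} (h : ω ≠ η) :
    ∃ k, η ∈ seqCyl ω k ∧ η k ≠ ω k := by
  have h' : ∃ k, η k ≠ ω k := by
    by_contra! H
    exact h (funext fun k => (H k).symm)
  classical
  exact ⟨Nat.find h', fun _ hi => not_not.1 (Nat.find_min h' hi), Nat.find_spec h'⟩

lemma prodN_pos {n : ℕ → ℕ} [∀ k, NeZero (n k)] (k : ℕ) : 0 < prodN n k :=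
  Finset.prod_pos fun _ _ => Nat.pos_of_ne_zero (NeZero.ne _)

lemma prodN_add_le {n : ℕ → ℕ} {N : ℕ} (hN : ∀ k, n k ≤ N) (k q : ℕ) :
    prodN n (k + q) ≤ prodN n k * N ^ q := by
  rw [prodN, Finset.prod_range_add, prodN]
  gcongr
  exact (Finset.prod_le_pow_card _ _ _ fun i _ => hN _).trans (by simp)

lemma le_prodN_add {n : ℕ → ℕ} (h2 : ∀ k, 2 ≤ n k) (k q : ℕ) :
    prodN n k * 2 ^ q ≤ prodN n (k + q) := by
  rw [prodN, prodN, Finset.prod_range_add]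
  gcongr
  exact (by simp : 2 ^ q ≤ 2 ^ (Finset.range q).card).trans
    (Finset.pow_card_le_prod _ _ _ fun i _ => h2 _)

/-- A map from the sequence space whose distances are comparable to `c ^ k`,
where `k` is the first index at which the sequences differ. -/
structure IsCoding {Y : Type*} [MetricSpace Y] (n : ℕ → ℕ) (c a b : ℝ)
    (π : SeqSpace n → Y) : Prop where
  dist_le : ∀ ω η k, η ∈ seqCyl ω k → dist (π η) (π ω) ≤ b * c ^ k
  le_dist : ∀ ω η k, η ∈ seqCyl ω k → η k ≠ ω k → a * c ^ k ≤ dist (π η) (π ω)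

variable {Y : Type*} [MetricSpace Y] {n : ℕ → ℕ} {c a b : ℝ} {π : SeqSpace n → Y}

lemma IsCoding.mono (h : IsCoding n c a b π) (hc : 0 < c) {a' b' : ℝ} (ha : a' ≤ a)
    (hb : b ≤ b') : IsCoding n c a' b' π where
  dist_le ω η k hk := (h.dist_le ω η k hk).trans (by gcongr)
  le_dist ω η k hk hne := le_trans (by gcongr) (h.le_dist ω η k hk hne)

lemma IsCoding.continuous (h : IsCoding n c a b π) (hc : 0 < c) (hc1 : c < 1) :
    Continuous π := by
  rw [Metric.continuous_iff']
  intro ω e he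
  have ht : Tendsto (fun k : ℕ => b * c ^ k) atTop (nhds (b * 0)) :=
    (tendsto_pow_atTop_nhds_zero_of_lt_one hc.le hc1).const_mul b
  rw [mul_zero] at ht
  obtain ⟨k, hk⟩ := (ht.eventually (gt_mem_nhds he)).exists
  filter_upwards [eventually_mem_seqCyl ω k] with η hη
  exact (h.dist_le ω η k hη).trans_lt hk

lemma IsCoding.injective (h : IsCoding n c a b π) (hc : 0 < c) (ha : 0 < a) :
    Function.Injective π := by
  intro ω η hωη
  by_contra hne
  obtain ⟨k, hk, hk'⟩ := exists_mem_seqCyl_ne hne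
  have := h.le_dist ω η k hk hk'
  rw [hωη, dist_self] at this
  have : 0 < a * c ^ k := by positivity
  linarith

lemma IsCoding.mem_seqCyl_of_dist_lt (h : IsCoding n c a b π) (hc : 0 < c) (hc1 : c < 1)
    (ha : 0 < a) {ω η : SeqSpace n} {k : ℕ} (hd : dist (π η) (π ω) < a * c ^ k) :
    η ∈ seqCyl ω k := by
  by_contra hη
  have hne : ω ≠ η := by
    rintro rfl
    exact hη fun i _ => rfl
  obtain ⟨j, hj, hj'⟩ := exists_mem_seqCyl_ne hne
  have hjk : j ≤ k := by
    by_contra! hlt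
    exact hη fun i hi => hj i (hi.trans hlt)
  have h1 := h.le_dist ω η j hj hj'
  have h2 : c ^ k ≤ c ^ j := pow_le_pow_of_le_one hc.le hc1.le hjk
  nlinarith

lemma IsCoding.bilipschitz {Z : Type*} [MetricSpace Z] {a' b' : ℝ} {σ : SeqSpace n → Z}
    (hπ : IsCoding n c a b π) (hσ : IsCoding n c a' b' σ) (ha : 0 < a)
    (hb' : 0 ≤ b') (ω η : SeqSpace n) : dist (σ ω) (σ η) ≤ b' / a * dist (π ω) (π η) := by
  by_cases hne : ω = η
  · simp [hne]
  obtain ⟨k, hk, hk'⟩ := exists_mem_seqCyl_ne hne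
  have h1 := hσ.dist_le ω η k hk
  have h2 := hπ.le_dist ω η k hk hk'
  rw [dist_comm (σ ω), dist_comm (π ω), div_mul_eq_mul_div, le_div_iff₀ ha]
  nlinarith

lemma exists_level (hb : 0 < b) (hc : 0 < c) (hc1 : c < 1) {r : ℝ} (hr : 0 < r) (hrb : r ≤ b) :
    ∃ k : ℕ, b * c ^ (k + 1) ≤ r ∧ r ≤ b * c ^ k := by
  obtain ⟨k, h1, h2⟩ := exists_nat_pow_near_of_lt_one (x := r / b) (by positivity)
    ((div_le_one hb).2 hrb) hc hc1
  refine ⟨k, ?_, ?_⟩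
  · rw [lt_div_iff₀ hb] at h1; linarith
  · rw [div_le_iff₀ hb] at h2; linarith

variable [MeasurableSpace Y] [BorelSpace Y] [∀ k, NeZero (n k)]

lemma IsCoding.le_measure_closedBall (h : IsCoding n c a b π) (hc : 0 < c) (hc1 : c < 1)
    (ω : SeqSpace n) {k : ℕ} {r : ℝ} (hr : b * c ^ k ≤ r) :
    ((prodN n k : ℕ) : ℝ)⁻¹ ≤
      (((seqMeasure n).map π) (Metric.closedBall (π ω) r)).toReal := by
  rw [Measure.map_apply (h.continuous hc hc1).measurable Metric.isClosed_closedBall.measurableSet,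
    ← seqMeasure_cyl_toReal ω k]
  exact ENNReal.toReal_mono (measure_ne_top _ _)
    (measure_mono fun η hη => (h.dist_le ω η k hη).trans hr)

lemma IsCoding.measure_closedBall_le (h : IsCoding n c a b π) (hc : 0 < c) (hc1 : c < 1)
    (ha : 0 < a) (ω : SeqSpace n) {k : ℕ} {r : ℝ} (hr : r < a * c ^ k) :
    (((seqMeasure n).map π) (Metric.closedBall (π ω) r)).toReal ≤ ((prodN n k : ℕ) : ℝ)⁻¹ := by
  rw [Measure.map_apply (h.continuous hc hc1).measurable Metric.isClosed_closedBall.measurableSet,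
    ← seqMeasure_cyl_toReal ω k]
  exact ENNReal.toReal_mono (measure_ne_top _ _) (measure_mono fun η hη =>
    h.mem_seqCyl_of_dist_lt hc hc1 ha ((Metric.mem_closedBall.1 hη).trans_lt hr))

/-- Two-sided bound for the measure of a ball of radius `r ∈ [b c ^ (k+1), b c ^ k]`. -/
lemma IsCoding.measure_closedBall_bounds (h : IsCoding n c a b π) (hc : 0 < c) (hc1 : c < 1)
    (ha : 0 < a) {N : ℕ} (hN : ∀ k, n k ≤ N) {p : ℕ} (hp : b * c ^ p < a)
    (ω : SeqSpace n) {k : ℕ} {r : ℝ} (h1 : b * c ^ (k + 1) ≤ r) (h2 : r ≤ b * c ^ k) :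
    (N * prodN n k : ℝ)⁻¹ ≤ (((seqMeasure n).map π) (Metric.closedBall (π ω) r)).toReal ∧
      (((seqMeasure n).map π) (Metric.closedBall (π ω) r)).toReal ≤ N ^ p / prodN n k := by
  have hpos := fun k => (Nat.cast_pos (α := ℝ)).2 (prodN_pos (n := n) k)
  constructor
  · refine le_trans ?_ (h.le_measure_closedBall hc hc1 ω h1)
    refine inv_anti₀ (hpos _) ?_
    have := prodN_add_le hN k 1
    rw [pow_one, mul_comm] at this
    exact_mod_cast this
  · have hle : (prodN n k : ℝ) ≤ prodN n (k - p) * N ^ p := by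
      have h3 := prodN_add_le hN (k - p) p
      have h4 : prodN n k ≤ prodN n (k - p + p) :=
        Finset.prod_le_prod_of_subset_of_one_le' (Finset.range_mono (by omega))
          fun i _ _ => Nat.one_le_iff_ne_zero.2 (NeZero.ne _)
      exact_mod_cast h4.trans h3
    refine le_trans (b := ((prodN n (k - p) : ℕ) : ℝ)⁻¹) ?_ ?_
    · by_cases hkp : p ≤ k
      · refine h.measure_closedBall_le hc hc1 ha ω ?_
        calc r ≤ b * c ^ (k - p + p) := by rwa [Nat.sub_add_cancel hkp]
          _ = b * c ^ p * c ^ (k - p) := by ring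
          _ < a * c ^ (k - p) := by gcongr
      · have := Measure.isProbabilityMeasure_map (μ := seqMeasure n)
          (h.continuous hc hc1).measurable.aemeasurable
        rw [Nat.sub_eq_zero_of_le (not_le.1 hkp).le]
        simpa [prodN] using ENNReal.toReal_mono ENNReal.one_ne_top prob_le_one
    · rw [inv_eq_one_div, div_le_div_iff₀ (hpos _) (hpos _)]
      linarith


lemma IsCoding.isHomog (h : IsCoding n c a b π) (hc : 0 < c) (hc1 : c < 1) (ha : 0 < a)
    (hb : 0 < b) {N : ℕ} (h2 : ∀ k, 2 ≤ n k) (hN : ∀ k, n k ≤ N) :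
    ∃ lam kappa del Del : ℝ,
      IsHomog (Set.range π) ((seqMeasure n).map π) lam kappa del Del := by
  obtain ⟨p, hp⟩ : ∃ p : ℕ, b * c ^ p < a := by
    obtain ⟨p, hp⟩ := exists_pow_lt_of_lt_one (div_pos ha hb) hc1
    exact ⟨p, by rwa [lt_div_iff₀' hb] at hp⟩
  obtain ⟨q, hq⟩ : ∃ q : ℕ, (2 * N ^ (p + 1) : ℝ) < 2 ^ q := pow_unbounded_of_one_lt _ one_lt_two
  have hbd := fun ω k r => h.measure_closedBall_bounds hc hc1 ha hN hp ω (k := k) (r := r)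
  have hpos := fun k => (Nat.cast_pos (α := ℝ)).2 (prodN_pos (n := n) k)
  have hN1 : (1 : ℝ) ≤ N := by exact_mod_cast one_le_two.trans ((h2 0).trans (hN 0))
  have hN0 : (0 : ℝ) < N := by linarith
  have hcont := h.continuous hc hc1
  have hcomp : IsCompact (Set.range π) := isCompact_range hcont
  have hprob := Measure.isProbabilityMeasure_map (μ := seqMeasure n)
    hcont.measurable.aemeasurable
  have hdiam : Metric.diam (Set.range π) ≤ b := by
    refine Metric.diam_le_of_forall_dist_le hb.le ?_
    rintro _ ⟨ω, rfl⟩ _ ⟨η, rfl⟩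
    simpa using h.dist_le η ω 0 (fun i hi => by omega)
  have hshift : ∀ (k : ℕ) (r : ℝ), b * c ^ (k + 1) ≤ r → r ≤ b * c ^ k →
      b * c ^ (k + q + 1) ≤ c ^ q * r ∧ c ^ q * r ≤ b * c ^ (k + q) := by
    intro k r h1 h2
    have hq : 0 < c ^ q := by positivity
    constructor
    · calc b * c ^ (k + q + 1) = c ^ q * (b * c ^ (k + 1)) := by ring
        _ ≤ _ := by gcongr
    · calc c ^ q * r ≤ c ^ q * (b * c ^ k) := by gcongr
        _ = _ := by ring
  have hlo : ∀ k, (prodN n k * 2 ^ q : ℝ) ≤ prodN n (k + q) := fun k => by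
    exact_mod_cast le_prodN_add h2 k q
  have hhi : ∀ k, (prodN n (k + q) : ℝ) ≤ prodN n k * N ^ q := fun k => by
    exact_mod_cast prodN_add_le hN k q
  refine ⟨N ^ (p + 1), c ^ q, 2, N ^ (p + 1 + q) + 2, hcomp, ?_, hprob, ?_, ?_, ?_, ?_,
    by positivity, ?_, one_lt_two, ?_, ?_, ?_⟩
  · let ω : SeqSpace n := fun k => ⟨0, by have := h2 k; omega⟩
    let η : SeqSpace n := fun k => ⟨1, by have := h2 k; omega⟩
    have h3 := h.le_dist ω η 0 (fun i hi => by omega) (by simp [ω, η])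
    have h4 := Metric.dist_le_diam_of_mem hcomp.isBounded (Set.mem_range_self η)
      (Set.mem_range_self ω)
    rw [pow_zero, mul_one] at h3
    linarith
  · rw [Measure.map_apply hcont.measurable hcomp.isClosed.measurableSet.compl]
    have : π ⁻¹' (Set.range π)ᶜ = ∅ := by ext; simp
    simp [this]
  · rintro _ ⟨ω, rfl⟩ r hr
    obtain ⟨k, hk⟩ := exists_pow_lt_of_lt_one (div_pos hr hb) hc1
    rw [lt_div_iff₀' hb] at hk
    have h3 := h.le_measure_closedBall hc hc1 ω hk.le
    exact (ENNReal.toReal_pos_iff.1 ((inv_pos.2 (hpos k)).trans_le h3)).1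
  · exact one_le_pow₀ hN1
  · rintro _ ⟨ω, rfl⟩ _ ⟨η, rfl⟩ r hr hrd
    obtain ⟨k, hk1, hk2⟩ := exists_level hb hc hc1 hr (hrd.trans hdiam)
    calc _ ≤ _ := (hbd ω k r hk1 hk2).2
      _ = N ^ (p + 1) * (N * prodN n k : ℝ)⁻¹ := by
        have := (hpos k).ne'
        field_simp
        ring
      _ ≤ _ := by gcongr; exact (hbd η k r hk1 hk2).1
  · refine pow_lt_one₀ hc.le hc1 ?_
    rintro rfl
    have : (1 : ℝ) ≤ N ^ (p + 1) := one_le_pow₀ hN1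
    simp only [pow_zero] at hq
    linarith
  · have : (0 : ℝ) < N ^ (p + 1 + q) := by positivity
    linarith
  · rintro _ ⟨ω, rfl⟩ r hr hrd
    obtain ⟨k, hk1, hk2⟩ := exists_level hb hc hc1 hr (hrd.trans hdiam)
    obtain ⟨hk3, hk4⟩ := hshift k r hk1 hk2
    calc _ ≤ 2 * (N ^ p / prodN n (k + q) : ℝ) := by
          gcongr; exact (hbd ω (k + q) _ hk3 hk4).2
      _ ≤ (N * prodN n k : ℝ)⁻¹ := by
        have h5 := hpos k
        have h6 := hpos (k + q)
        rw [inv_eq_one_div, ← mul_div_assoc, div_le_div_iff₀ h6 (by positivity)]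
        calc 2 * (N : ℝ) ^ p * (N * prodN n k) = prodN n k * (2 * N ^ (p + 1)) := by ring
          _ ≤ prodN n k * 2 ^ q := by gcongr
          _ ≤ 1 * prodN n (k + q) := by linarith [hlo k]
      _ ≤ _ := (hbd ω k r hk1 hk2).1
  · rintro _ ⟨ω, rfl⟩ r hr hrd
    obtain ⟨k, hk1, hk2⟩ := exists_level hb hc hc1 hr (hrd.trans hdiam)
    obtain ⟨hk3, hk4⟩ := hshift k r hk1 hk2
    calc _ ≤ (N ^ p / prodN n k : ℝ) := (hbd ω k r hk1 hk2).2
      _ ≤ N ^ (p + 1 + q) * (N * prodN n (k + q) : ℝ)⁻¹ := by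
        have h5 := hpos k
        have h6 := hpos (k + q)
        rw [← div_eq_mul_inv, div_le_div_iff₀ h5 (by positivity)]
        calc (N : ℝ) ^ p * (N * prodN n (k + q)) = N ^ (p + 1) * prodN n (k + q) := by ring
          _ ≤ N ^ (p + 1) * (prodN n k * N ^ q) := by gcongr; exact hhi k
          _ = _ := by ring
      _ ≤ (N ^ (p + 1 + q) + 2) * (N * prodN n (k + q) : ℝ)⁻¹ := by gcongr; linarith
      _ ≤ _ := by gcongr; exact (hbd ω (k + q) _ hk3 hk4).1

lemma IsCoding.abs_log_measure_add_le (h : IsCoding n c a b π) (hc : 0 < c) (hc1 : c < 1)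
    (ha : 0 < a) (hb : 0 < b) {N : ℕ} (hN : ∀ k, n k ≤ N) :
    ∃ K : ℝ, ∀ (ω : SeqSpace n) (k : ℕ) (r : ℝ), b * c ^ (k + 1) ≤ r → r ≤ b * c ^ k →
      |Real.log (((seqMeasure n).map π) (Metric.closedBall (π ω) r)).toReal +
        Real.log (prodN n k)| ≤ K := by
  obtain ⟨p, hp⟩ : ∃ p : ℕ, b * c ^ p < a := by
    obtain ⟨p, hp⟩ := exists_pow_lt_of_lt_one (div_pos ha hb) hc1
    exact ⟨p, by rwa [lt_div_iff₀' hb] at hp⟩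
  have hN1 : (1 : ℝ) ≤ N := by
    exact_mod_cast (Nat.one_le_iff_ne_zero.2 (NeZero.ne (n 0))).trans (hN 0)
  have hlN := Real.log_nonneg hN1
  refine ⟨(p + 1) * Real.log N, fun ω k r h1 h2 => ?_⟩
  obtain ⟨h3, h4⟩ := h.measure_closedBall_bounds hc hc1 ha hN hp ω h1 h2
  have hpos := (Nat.cast_pos (α := ℝ)).2 (prodN_pos (n := n) k)
  have h5 : (0 : ℝ) < (N * prodN n k : ℝ)⁻¹ := by positivity
  have h6 := Real.log_le_log h5 h3
  have h7 := Real.log_le_log (h5.trans_le h3) h4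
  rw [Real.log_inv, Real.log_mul (by positivity) hpos.ne'] at h6
  rw [Real.log_div (by positivity) hpos.ne', Real.log_pow] at h7
  have h8 : 0 ≤ (p : ℝ) * Real.log N := by positivity
  rw [abs_le]
  constructor <;> linarith

end Coding

section Corners

/-- The `j`-th binary digit of `i`, as a real number. -/
def bitDigit (i j : ℕ) : ℝ := if i.testBit j then 1 else 0

lemma bitDigit_nonneg (i j : ℕ) : 0 ≤ bitDigit i j := by
  unfold bitDigit; split_ifs <;> norm_num

lemma bitDigit_le_one (i j : ℕ) : bitDigit i j ≤ 1 := by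
  unfold bitDigit; split_ifs <;> norm_num

/-- The `j`-th coordinate of the lower corner of the cube of level `k` indexed by `v`. -/
def cubeCorner (c : ℝ) (v : ℕ → ℕ) (k j : ℕ) : ℝ :=
  ∑ i ∈ Finset.range k, c ^ i * (1 - c) * bitDigit (v i) j

lemma cubeCorner_succ (c : ℝ) (v : ℕ → ℕ) (k j : ℕ) :
    cubeCorner c v (k + 1) j = cubeCorner c v k j + c ^ k * (1 - c) * bitDigit (v k) j :=
  Finset.sum_range_succ _ _

lemma cubeCorner_congr {c : ℝ} {v v' : ℕ → ℕ} {k : ℕ} (h : ∀ i < k, v i = v' i) (j : ℕ) :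
    cubeCorner c v k j = cubeCorner c v' k j :=
  Finset.sum_congr rfl fun i hi => by rw [h i (Finset.mem_range.1 hi)]

lemma cubeCorner_monotone {c : ℝ} (hc : 0 < c) (hc1 : c < 1) (v : ℕ → ℕ) (j : ℕ) :
    Monotone fun k => cubeCorner c v k j := by
  refine monotone_nat_of_le_succ fun k => ?_
  rw [cubeCorner_succ]
  have := mul_nonneg (mul_nonneg (pow_pos hc k).le (sub_nonneg.2 hc1.le)) (bitDigit_nonneg (v k) j)
  linarith

lemma cubeCorner_add_antitone {c : ℝ} (hc : 0 < c) (hc1 : c < 1) (v : ℕ → ℕ) (j : ℕ) :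
    Antitone fun k => cubeCorner c v k j + c ^ k := by
  refine antitone_nat_of_succ_le fun k => ?_
  rw [cubeCorner_succ, pow_succ]
  have := mul_nonneg (mul_nonneg (pow_pos hc k).le (sub_nonneg.2 hc1.le))
    (sub_nonneg.2 (bitDigit_le_one (v k) j))
  linarith

/-- The cube of `ℝ^d` of side `c ^ |w|` indexed by the word `w`: the children of a cube
are the cubes of side ratio `c` sitting at its corners. -/
def wordCube (d : ℕ) (c : ℝ) (w : List ℕ) : Set (EuclideanSpace ℝ (Fin d)) :=
  {x | ∀ j : Fin d, cubeCorner c (fun i => w.getD i 0) w.length j ≤ x j ∧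
    x j ≤ cubeCorner c (fun i => w.getD i 0) w.length j + c ^ w.length}

/-- The point of `ℝ^d` coded by a sequence: the intersection of the cubes of its prefixes. -/
def cubePoint (d : ℕ) (c : ℝ) (v : ℕ → ℕ) : EuclideanSpace ℝ (Fin d) :=
  WithLp.toLp 2 fun j => ⨆ k, cubeCorner c v k j

lemma cubePoint_mem {d : ℕ} {c : ℝ} (hc : 0 < c) (hc1 : c < 1) (v : ℕ → ℕ) (k : ℕ) (j : Fin d) :
    cubeCorner c v k j ≤ cubePoint d c v j ∧ cubePoint d c v j ≤ cubeCorner c v k j + c ^ k := by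
  have := Monotone.ciSup_mem_iInter_Icc_of_antitone (cubeCorner_monotone hc hc1 v j)
    (cubeCorner_add_antitone hc hc1 v j) (fun k => by simpa using (pow_pos hc k).le)
  exact Set.mem_iInter.1 this k

lemma dist_le_of_forall_coord {d : ℕ} {x y : EuclideanSpace ℝ (Fin d)} {t : ℝ} (ht : 0 ≤ t)
    (h : ∀ j, |x j - y j| ≤ t) : dist x y ≤ √d * t := by
  rw [EuclideanSpace.dist_eq]
  calc √(∑ j, dist (x j) (y j) ^ 2) ≤ √(∑ _j : Fin d, t ^ 2) := by
        gcongr with j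
        exact h j
    _ = √d * t := by simp [Real.sqrt_sq ht]

lemma abs_coord_le_dist {d : ℕ} (x y : EuclideanSpace ℝ (Fin d)) (j : Fin d) :
    |x j - y j| ≤ dist x y := by
  rw [dist_eq_norm]
  exact PiLp.norm_apply_le (x - y) j

lemma cubeCorner_append (c : ℝ) (w : List ℕ) (i j : ℕ) :
    cubeCorner c (fun m => (w ++ [i]).getD m 0) (w ++ [i]).length j =
      cubeCorner c (fun m => w.getD m 0) w.length j + c ^ w.length * (1 - c) * bitDigit i j := by
  rw [List.length_append, List.length_singleton, cubeCorner_succ]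
  congr 1
  · exact cubeCorner_congr (fun m hm => by simp [List.getElem?_append_left hm]) j
  · simp

lemma exists_bitDigit_ne {d N i i' : ℕ} (hd : N ≤ 2 ^ d) (hi : i < N) (hi' : i' < N)
    (hne : i ≠ i') : ∃ j : Fin d, bitDigit i j ≠ bitDigit i' j := by
  by_contra! H
  refine hne (Nat.eq_of_testBit_eq fun j => ?_)
  by_cases hj : j < d
  · have := H ⟨j, hj⟩
    unfold bitDigit at this
    by_cases h1 : i.testBit j <;> by_cases h2 : i'.testBit j <;> simp_all
  · have hle : 2 ^ d ≤ 2 ^ j := Nat.pow_le_pow_right two_pos (not_lt.1 hj)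
    rw [Nat.testBit_lt_two_pow (by omega), Nat.testBit_lt_two_pow (by omega)]

/-- Two cubes at different corners of the same cube are separated in some coordinate. -/
lemma cubeCorner_separated {c : ℝ} (hc : 0 < c) (hc2 : c ≤ 1 / 4) {v v' : ℕ → ℕ} {k j : ℕ}
    (h : ∀ i < k, v i = v' i) (hne : bitDigit (v k) j ≠ bitDigit (v' k) j) {x y : ℝ}
    (hx : cubeCorner c v (k + 1) j ≤ x ∧ x ≤ cubeCorner c v (k + 1) j + c ^ (k + 1))
    (hy : cubeCorner c v' (k + 1) j ≤ y ∧ y ≤ cubeCorner c v' (k + 1) j + c ^ (k + 1)) :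
    1 / 2 * c ^ k ≤ |x - y| := by
  rw [cubeCorner_succ, pow_succ] at hx hy
  rw [cubeCorner_congr h] at hx
  have hck := pow_pos hc k
  have hcc : c ^ k * c ≤ c ^ k * (1 / 4) := by gcongr
  rw [le_abs]
  unfold bitDigit at hne hx hy
  split_ifs at hne hx hy
  · exact absurd rfl hne
  · left; linarith [hx.1, hy.2]
  · right; linarith [hx.2, hy.1]
  · exact absurd rfl hne

lemma isCoding_cubePoint {n : ℕ → ℕ} {d : ℕ} {c : ℝ} (hc : 0 < c) (hc2 : c ≤ 1 / 4)
    (hd : ∀ k, n k ≤ 2 ^ d) :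
    IsCoding n c (1 / 2) √d fun ω => cubePoint d c fun i => ω i where
  dist_le ω η k h := by
    refine dist_le_of_forall_coord (by positivity) fun j => ?_
    have h1 := cubePoint_mem hc (by linarith) (fun i => (ω i : ℕ)) k j
    have h2 := cubePoint_mem hc (by linarith) (fun i => (η i : ℕ)) k j
    rw [cubeCorner_congr (v' := fun i => (ω i : ℕ)) fun i hi => by rw [h i hi]] at h2
    rw [abs_le]
    constructor <;> linarith
  le_dist ω η k h hne := by
    obtain ⟨j, hj⟩ := exists_bitDigit_ne (hd k) (η k).2 (ω k).2 (fun H => hne (Fin.ext H))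
    exact (cubeCorner_separated hc hc2 (v := fun i => (η i : ℕ)) (v' := fun i => (ω i : ℕ))
      (fun i hi => by rw [h i hi]) hj (cubePoint_mem hc (by linarith) _ (k + 1) j)
      (cubePoint_mem hc (by linarith) _ (k + 1) j)).trans (abs_coord_le_dist _ _ j)

lemma isMoranSystem_wordCube {n : ℕ → ℕ} {d : ℕ} {c : ℝ} (hc : 0 < c) (hc2 : c ≤ 1 / 4)
    (h2 : ∀ k, 2 ≤ n k) (hd : ∀ k, n k ≤ 2 ^ d) :
    IsMoranSystem (wordCube d c []) n (fun _ => c) (wordCube d c) where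
  compact := by
    refine Metric.isCompact_of_isClosed_isBounded ?_ ?_
    · have h : wordCube d c [] = (fun x : EuclideanSpace ℝ (Fin d) => x.ofLp) ⁻¹'
          Set.univ.pi fun j : Fin d => Set.Icc (cubeCorner c (fun i => [].getD i 0) 0 j)
            (cubeCorner c (fun i => [].getD i 0) 0 j + c ^ 0) := by
        ext x
        exact ⟨fun h j _ => h j, fun h j => h j trivial⟩
      rw [h]
      exact (isClosed_set_pi fun _ _ => isClosed_Icc).preimage (PiLp.continuous_ofLp 2 _)
    · refine Metric.isBounded_iff.2 ⟨√d * 1, fun x hx y hy => ?_⟩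
      refine dist_le_of_forall_coord zero_le_one fun j => ?_
      have h1 := hx j
      have h2 := hy j
      simp only [List.length_nil, pow_zero] at h1 h2
      rw [abs_le]
      constructor <;> linarith
  int_nonempty := by
    refine ⟨WithLp.toLp 2 fun _ => 1 / 2, ?_⟩
    rw [mem_interior]
    refine ⟨(fun x : EuclideanSpace ℝ (Fin d) => x.ofLp) ⁻¹'
      Set.univ.pi fun _ : Fin d => Set.Ioo 0 1, fun x hx j => ?_, ?_, fun j _ => by norm_num⟩
    · simpa [cubeCorner] using ⟨(hx j trivial).1.le, (hx j trivial).2.le⟩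
    · exact (isOpen_set_pi Set.finite_univ fun _ _ => isOpen_Ioo).preimage
        (PiLp.continuous_ofLp 2 _)
  two_le_n := h2
  c_pos _ := hc
  c_lt_one _ := by linarith
  c_inf_pos := ⟨c, hc, fun _ => le_rfl⟩
  root := rfl
  subset w _ i _ x hx j := by
    have h1 := hx j
    have hb := bitDigit_nonneg i j
    have hb' := bitDigit_le_one i j
    rw [cubeCorner_append, List.length_append, List.length_singleton, pow_succ] at h1
    have hck := pow_pos hc w.length
    have h3 : 0 ≤ c ^ w.length * (1 - c) := mul_nonneg hck.le (by linarith)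
    constructor <;> nlinarith
  similar w _ i _ := by
    let p : EuclideanSpace ℝ (Fin d) :=
      WithLp.toLp 2 fun j => cubeCorner c (fun m => w.getD m 0) w.length j
    let p' : EuclideanSpace ℝ (Fin d) :=
      WithLp.toLp 2 fun j => cubeCorner c (fun m => (w ++ [i]).getD m 0) (w ++ [i]).length j
    refine ⟨fun x => p' + c • (x - p), fun x y => ?_, ?_⟩
    · rw [dist_add_left, dist_smul₀, dist_sub_right, Real.norm_of_nonneg hc.le]
    · have hp : ∀ j, p.ofLp j = cubeCorner c (fun m => w.getD m 0) w.length j := fun _ => rfl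
      have hp' : ∀ j, p'.ofLp j =
        cubeCorner c (fun m => (w ++ [i]).getD m 0) (w ++ [i]).length j := fun _ => rfl
      have hl : c ^ (w ++ [i]).length = c * c ^ w.length := by simp [pow_succ']
      ext y
      constructor
      · intro hy
        refine ⟨p + c⁻¹ • (y - p'), fun j => ?_, ?_⟩
        · have h1 := hy j
          rw [hl, ← hp'] at h1
          simp only [PiLp.add_apply, PiLp.smul_apply, PiLp.sub_apply, smul_eq_mul, ← hp]
          constructor
          · have : 0 ≤ c⁻¹ * (y.ofLp j - p'.ofLp j) :=
              mul_nonneg (inv_nonneg.2 hc.le) (by linarith)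
            linarith
          · have : c⁻¹ * (y.ofLp j - p'.ofLp j) ≤ c⁻¹ * (c * c ^ w.length) := by
              gcongr; linarith
            rw [inv_mul_cancel_left₀ hc.ne'] at this
            linarith
        · simp [smul_smul, hc.ne']
      · rintro ⟨x, hx, rfl⟩ j
        have h1 := hx j
        rw [← hp] at h1
        rw [hl, ← hp']
        simp only [PiLp.add_apply, PiLp.smul_apply, PiLp.sub_apply, smul_eq_mul]
        constructor <;> nlinarith
  disj_int w _ i hi i' hi' hne := by
    refine Disjoint.mono interior_subset interior_subset (Set.disjoint_left.2 fun x hx hx' => ?_)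
    obtain ⟨j, hj⟩ := exists_bitDigit_ne (hd _) hi hi' hne
    have h1 := hx j
    have h2 := hx' j
    rw [List.length_append, List.length_singleton] at h1 h2
    have := cubeCorner_separated hc hc2 (fun m hm => by simp [List.getElem?_append_left hm])
      (by simpa using hj) h1 h2
    have hck := pow_pos hc w.length
    rw [sub_self, abs_zero] at this
    linarith

lemma moranSet_wordCube {n : ℕ → ℕ} {d : ℕ} {c : ℝ} (hc : 0 < c) (hc2 : c ≤ 1 / 4)
    (h2 : ∀ k, 2 ≤ n k) (hd : ∀ k, n k ≤ 2 ^ d) :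
    moranSet n (wordCube d c) =
      Set.range fun ω : SeqSpace n => cubePoint d c fun i => ω i := by
  have hc1 : c < 1 := by linarith
  refine Set.Subset.antisymm (fun x hx => ?_) ?_
  · have hcl : IsClosed (Set.range fun ω : SeqSpace n => cubePoint d c fun i => ω i) :=
      (isCompact_range ((isCoding_cubePoint hc hc2 hd).continuous hc hc1)).isClosed
    rw [← hcl.closure_eq, Metric.mem_closure_iff]
    intro e he
    have ht : Tendsto (fun k : ℕ => √d * c ^ k) atTop (nhds (√d * 0)) :=
      (tendsto_pow_atTop_nhds_zero_of_lt_one hc.le hc1).const_mul _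
    rw [mul_zero] at ht
    obtain ⟨k, hk⟩ := (ht.eventually (gt_mem_nhds he)).exists
    obtain ⟨w, ⟨rfl, hadm⟩, hxw⟩ : ∃ w : List ℕ, (w.length = k ∧ AdmWord n w) ∧
        x ∈ wordCube d c w := by
      simpa using Set.mem_iInter.1 hx k
    have hlt : ∀ i, w.getD i 0 < n i := by
      intro i
      by_cases hi : i < w.length
      · rw [List.getD_eq_getElem _ _ hi]
        exact hadm ⟨i, hi⟩
      · rw [List.getD_eq_default _ _ (not_lt.1 hi)]
        linarith [h2 i]
    refine ⟨_, ⟨fun i => ⟨w.getD i 0, hlt i⟩, rfl⟩, lt_of_le_of_lt ?_ hk⟩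
    refine dist_le_of_forall_coord (by positivity) fun j => ?_
    have h3 := hxw j
    have h4 := cubePoint_mem hc hc1 (fun i => w.getD i 0) w.length j
    rw [abs_le]
    constructor <;> linarith
  · rintro _ ⟨ω, rfl⟩
    refine Set.mem_iInter.2 fun k => ?_
    simp only [Set.mem_iUnion]
    refine ⟨(List.range k).map fun i => (ω i : ℕ), ⟨by simp, fun i => ?_⟩, fun j => ?_⟩
    · rw [List.get_eq_getElem, List.getElem_map, List.getElem_range]
      exact (ω i).2
    · rw [List.length_map, List.length_range,
        cubeCorner_congr (v' := fun i => (ω i : ℕ)) fun i hi => by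
          rw [List.getD_eq_getElem _ _ (by simpa using hi), List.getElem_map, List.getElem_range]]
      exact cubePoint_mem hc hc1 _ k j

end Corners

section Homogeneous

variable {X : Type*} [MetricSpace X]

/-- `n` points of `A` at distance at most `R` from `x` and more than `4τ` from each other. -/
structure IsSepFamily (A : Set X) (τ R : ℝ) (x : X) {n : ℕ} (g : Fin n → X) : Prop where
  mem : ∀ i, g i ∈ A
  dist_le : ∀ i, dist (g i) x ≤ R
  sep : ∀ i j, i ≠ j → 4 * τ < dist (g i) (g j)

lemma IsSepFamily.cons {A : Set X} {τ R : ℝ} {x y : X} {n : ℕ} {g : Fin n → X}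
    (hg : IsSepFamily A τ R x g) (hy : y ∈ A) (hyx : dist y x ≤ R)
    (h : ∀ i, 4 * τ < dist (g i) y) :
    IsSepFamily A τ R x (Fin.cons y g : Fin (n + 1) → X) where
  mem := Fin.cases hy hg.mem
  dist_le := Fin.cases hyx hg.dist_le
  sep i j hij := by
    induction i using Fin.cases with
    | zero =>
      induction j using Fin.cases with
      | zero => exact absurd rfl hij
      | succ j => simpa [dist_comm] using h j
    | succ i =>
      induction j using Fin.cases with
      | zero => simpa using h i
      | succ j => simpa using hg.sep i j (fun H => hij (H ▸ rfl))

variable [MeasurableSpace X]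

/-- The mass of the closed ball of radius `r` at `x`. -/
def ballMass (μ : Measure X) (x : X) (r : ℝ) : ℝ := (μ (Metric.closedBall x r)).toReal

variable {A : Set X} {μ : Measure X} {lam kappa del Del : ℝ}

namespace IsHomog

lemma ballMass_mono (hA : IsHomog A μ lam kappa del Del) (x : X) {r s : ℝ} (h : r ≤ s) :
    ballMass μ x r ≤ ballMass μ x s := by
  have := hA.prob
  exact ENNReal.toReal_mono (measure_ne_top _ _)
    (measure_mono (Metric.closedBall_subset_closedBall h))

lemma ballMass_le_one (hA : IsHomog A μ lam kappa del Del) (x : X) (r : ℝ) :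
    ballMass μ x r ≤ 1 := by
  have := hA.prob
  exact ENNReal.toReal_mono ENNReal.one_ne_top prob_le_one

lemma ballMass_pos (hA : IsHomog A μ lam kappa del Del) {x : X} (hx : x ∈ A) {r : ℝ}
    (hr : 0 < r) : 0 < ballMass μ x r := by
  have := hA.prob
  exact ENNReal.toReal_pos (hA.supp_pos x hx r hr).ne' (measure_ne_top _ _)

lemma ballMass_eq_one (hA : IsHomog A μ lam kappa del Del) {x : X} (hx : x ∈ A) {r : ℝ}
    (hr : Metric.diam A ≤ r) : ballMass μ x r = 1 := by
  have := hA.prob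
  refine le_antisymm (hA.ballMass_le_one x r) ?_
  have hsub : A ⊆ Metric.closedBall x r := fun y hy =>
    (Metric.dist_le_diam_of_mem hA.compact.isBounded hy hx).trans hr
  have h1 : μ (Metric.closedBall x r)ᶜ = 0 :=
    measure_mono_null (Set.compl_subset_compl.2 hsub) hA.supp_null
  have h2 : (1 : ℝ≥0∞) ≤ μ (Metric.closedBall x r) := by
    calc (1 : ℝ≥0∞) = μ Set.univ := measure_univ.symm
      _ ≤ μ (Metric.closedBall x r) + μ (Metric.closedBall x r)ᶜ := by
        rw [← Set.union_compl_self (Metric.closedBall x r)]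
        exact measure_union_le _ _
      _ = μ (Metric.closedBall x r) := by rw [h1, add_zero]
  simpa [ballMass] using ENNReal.toReal_mono (measure_ne_top _ _) h2

lemma Del_pos (hA : IsHomog A μ lam kappa del Del) : 1 < Del :=
  hA.one_lt_del.trans_le hA.del_le_Del

lemma ballMass_le_mul (hA : IsHomog A μ lam kappa del Del) {x y : X} (hx : x ∈ A) (hy : y ∈ A)
    {r : ℝ} (hr : 0 < r) : ballMass μ x r ≤ lam * ballMass μ y r := by
  rcases le_total r (Metric.diam A) with h | h
  · exact hA.ratio_le x hx y hy r hr h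
  · rw [hA.ballMass_eq_one hx h, hA.ballMass_eq_one hy h, mul_one]
    exact hA.one_le_lam

lemma ballMass_le_pow_mul (hA : IsHomog A μ lam kappa del Del) {x : X} (hx : x ∈ A)
    {r : ℝ} (hr : 0 < r) (t : ℕ) : ballMass μ x r ≤ Del ^ t * ballMass μ x (kappa ^ t * r) := by
  have hk := hA.kappa_pos
  have step : ∀ s : ℝ, 0 < s → ballMass μ x s ≤ Del * ballMass μ x (kappa * s) := by
    intro s hs
    rcases le_total s (Metric.diam A) with h | h
    · exact hA.scale_upper x hx s hs h
    · calc ballMass μ x s ≤ 1 := hA.ballMass_le_one x s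
        _ = ballMass μ x (Metric.diam A) := (hA.ballMass_eq_one hx le_rfl).symm
        _ ≤ Del * ballMass μ x (kappa * Metric.diam A) :=
          hA.scale_upper x hx _ hA.diam_pos le_rfl
        _ ≤ Del * ballMass μ x (kappa * s) := by
          have := hA.Del_pos
          gcongr
          exact hA.ballMass_mono x (by gcongr)
  induction t with
  | zero => simp
  | succ t ih =>
    have h1 := step (kappa ^ t * r) (by positivity)
    have h2 : 0 < Del ^ t := pow_pos (by linarith [hA.Del_pos]) t
    calc ballMass μ x r ≤ Del ^ t * ballMass μ x (kappa ^ t * r) := ih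
      _ ≤ Del ^ t * (Del * ballMass μ x (kappa * (kappa ^ t * r))) := by gcongr
      _ = _ := by rw [← mul_assoc, ← mul_assoc kappa, ← pow_succ, ← pow_succ']

lemma pow_mul_ballMass_le (hA : IsHomog A μ lam kappa del Del) {x : X} (hx : x ∈ A)
    {r : ℝ} (hr : 0 < r) (hrD : r ≤ Metric.diam A) (t : ℕ) :
    del ^ t * ballMass μ x (kappa ^ t * r) ≤ ballMass μ x r := by
  have hk := hA.kappa_pos
  induction t with
  | zero => simp
  | succ t ih =>
    have h3 : kappa ^ t * r ≤ Metric.diam A :=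
      (mul_le_of_le_one_left hr.le (pow_le_one₀ hk.le hA.kappa_lt_one.le)).trans hrD
    have h1 : del * ballMass μ x (kappa * (kappa ^ t * r)) ≤ ballMass μ x (kappa ^ t * r) :=
      hA.scale_lower x hx (kappa ^ t * r) (by positivity) h3
    have h2 : 0 < del ^ t := pow_pos (by linarith [hA.one_lt_del]) t
    calc del ^ (t + 1) * ballMass μ x (kappa ^ (t + 1) * r)
        = del ^ t * (del * ballMass μ x (kappa * (kappa ^ t * r))) := by
          rw [← mul_assoc, ← mul_assoc kappa, ← pow_succ, ← pow_succ']
      _ ≤ del ^ t * ballMass μ x (kappa ^ t * r) := by gcongr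
      _ ≤ _ := ih

end IsHomog

lemma IsHomog.ballMass_le_card_mul (hA : IsHomog A μ lam kappa del Del) {t : ℕ}
    (ht : kappa ^ t ≤ 1 / 4) {τ R : ℝ} (hτ : 0 < τ) (hR : τ ≤ R) {x x₀ : X} (hx : x ∈ A)
    (hx₀ : x₀ ∈ A) {n : ℕ} {g : Fin n → X} (hg : IsSepFamily A τ R x g)
    (hmax : ¬ ∃ g : Fin (n + 1) → X, IsSepFamily A τ R x g) :
    ballMass μ x₀ R ≤ lam ^ 2 * Del ^ t * (n * ballMass μ x₀ τ) := by
  have := hA.prob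
  have hlam : 0 < lam := by linarith [hA.one_le_lam]
  have hDel : 0 < Del ^ t := pow_pos (by linarith [hA.Del_pos]) t
  have hcover : Metric.closedBall x R ⊆ Aᶜ ∪ ⋃ i, Metric.closedBall (g i) (4 * τ) := by
    intro y hy
    by_cases hyA : y ∈ A
    · right
      by_contra hcon
      simp only [Set.mem_iUnion, Metric.mem_closedBall, not_exists, not_le] at hcon
      exact hmax ⟨_, hg.cons hyA hy fun i => by rw [dist_comm]; exact hcon i⟩
    · exact Or.inl hyA
  have hsum : ballMass μ x R ≤ ∑ i, ballMass μ (g i) (4 * τ) := by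
    calc ballMass μ x R ≤ μ.real (Aᶜ ∪ ⋃ i, Metric.closedBall (g i) (4 * τ)) :=
          measureReal_mono hcover
      _ ≤ μ.real Aᶜ + μ.real (⋃ i, Metric.closedBall (g i) (4 * τ)) := measureReal_union_le _ _
      _ = μ.real (⋃ i, Metric.closedBall (g i) (4 * τ)) := by
        simp [Measure.real, hA.supp_null]
      _ ≤ _ := measureReal_iUnion_fintype_le _
  calc ballMass μ x₀ R ≤ lam * ballMass μ x R := hA.ballMass_le_mul hx₀ hx (hτ.trans_le hR)
    _ ≤ lam * ∑ i, lam * (Del ^ t * ballMass μ x₀ τ) := by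
      gcongr lam * ?_
      refine hsum.trans (Finset.sum_le_sum fun i _ => ?_)
      refine (hA.ballMass_le_mul (hg.mem i) hx₀ (by linarith)).trans ?_
      gcongr lam * ?_
      refine (hA.ballMass_le_pow_mul hx₀ (by linarith) t).trans ?_
      gcongr
      exact hA.ballMass_mono x₀ (by nlinarith)
    _ = _ := by simp; ring

variable [BorelSpace X]

lemma IsHomog.card_sepFamily_le (hA : IsHomog A μ lam kappa del Del) {t : ℕ}
    (ht : kappa ^ t ≤ 1 / 4) {τ R : ℝ} (hτ : 0 < τ) (hR : τ ≤ R) {x x₀ : X} (hx : x ∈ A)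
    (hx₀ : x₀ ∈ A) {n : ℕ} {g : Fin n → X} (hg : IsSepFamily A τ R x g) :
    n * ballMass μ x₀ τ ≤ lam ^ 2 * Del ^ t * ballMass μ x₀ R := by
  have := hA.prob
  have hlam : 0 < lam := by linarith [hA.one_le_lam]
  have hDel : 0 < Del ^ t := pow_pos (by linarith [hA.Del_pos]) t
  have hdisj : Pairwise (Function.onFun Disjoint fun i => Metric.closedBall (g i) τ) := by
    intro i j hij
    exact Metric.closedBall_disjoint_closedBall (by linarith [hg.sep i j hij])
  have hunion : ∑ i, ballMass μ (g i) τ ≤ ballMass μ x (2 * R) := by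
    have h1 := measureReal_iUnion_fintype (μ := μ) hdisj
      (fun i => Metric.isClosed_closedBall.measurableSet)
    calc ∑ i, ballMass μ (g i) τ = μ.real (⋃ i, Metric.closedBall (g i) τ) := h1.symm
      _ ≤ ballMass μ x (2 * R) := by
        refine measureReal_mono (Set.iUnion_subset fun i => ?_)
        exact Metric.closedBall_subset_closedBall' (by linarith [hg.dist_le i])
  calc n * ballMass μ x₀ τ = ∑ _i : Fin n, ballMass μ x₀ τ := by simp
    _ ≤ ∑ i, lam * ballMass μ (g i) τ := by
      gcongr with i
      exact hA.ballMass_le_mul hx₀ (hg.mem i) hτ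
    _ = lam * ∑ i, ballMass μ (g i) τ := by rw [Finset.mul_sum]
    _ ≤ lam * (lam * ballMass μ x₀ (2 * R)) := by
      gcongr
      exact hunion.trans (hA.ballMass_le_mul hx hx₀ (by linarith))
    _ ≤ lam * (lam * (Del ^ t * ballMass μ x₀ (kappa ^ t * (2 * R)))) := by
      gcongr
      exact hA.ballMass_le_pow_mul hx₀ (by linarith) t
    _ ≤ lam * (lam * (Del ^ t * ballMass μ x₀ R)) := by
      gcongr
      exact hA.ballMass_mono x₀ (by nlinarith)
    _ = _ := by ring

/-- A branching number valid at all points of `A`, comparable to the ratio of ball masses;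
at scales `R ≥ diam A` the corresponding families are `4τ`-nets. -/
lemma IsHomog.exists_branching (hA : IsHomog A μ lam kappa del Del) {t : ℕ}
    (ht : kappa ^ t ≤ 1 / 4) {τ R : ℝ} (hτ : 0 < τ) (hR : τ ≤ R) {x₀ : X} (hx₀ : x₀ ∈ A) :
    ∃ n : ℕ, (∀ x ∈ A, ∃ g : Fin n → X, IsSepFamily A τ R x g) ∧
      ballMass μ x₀ R ≤ lam ^ 2 * Del ^ t * (n * ballMass μ x₀ τ) ∧
      n * ballMass μ x₀ τ ≤ lam ^ 2 * Del ^ t * ballMass μ x₀ R ∧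
      (Metric.diam A ≤ R → ∀ g : Fin n → X, IsSepFamily A τ R x₀ g →
        ∀ y ∈ A, ∃ i, dist (g i) y ≤ 4 * τ) := by
  let valid : ℕ → Prop := fun n => ∀ x ∈ A, ∃ g : Fin n → X, IsSepFamily A τ R x g
  obtain ⟨n, hn, hn'⟩ : ∃ n, valid n ∧ ¬ valid (n + 1) := by
    by_contra! hcon
    have hall : ∀ n, valid n := fun n => by
      induction n with
      | zero => exact fun x _ => ⟨Fin.elim0, fun i => i.elim0, fun i => i.elim0, fun i => i.elim0⟩
      | succ n ih => exact hcon n ih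
    have hpos := hA.ballMass_pos hx₀ hτ
    obtain ⟨n, hn⟩ := exists_nat_gt (lam ^ 2 * Del ^ t * ballMass μ x₀ R / ballMass μ x₀ τ)
    obtain ⟨g, hg⟩ := hall n x₀ hx₀
    rw [div_lt_iff₀ hpos] at hn
    linarith [hA.card_sepFamily_le ht hτ hR hx₀ hx₀ hg]
  refine ⟨n, hn, ?_, ?_, fun hD g hg y hy => ?_⟩
  · simp only [valid, not_forall] at hn'
    obtain ⟨x, hx, hmax⟩ := hn'
    obtain ⟨g, hg⟩ := hn x hx
    exact hA.ballMass_le_card_mul ht hτ hR hx hx₀ hg hmax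
  · obtain ⟨g, hg⟩ := hn x₀ hx₀
    exact hA.card_sepFamily_le ht hτ hR hx₀ hx₀ hg
  · by_contra! hcon
    have hball : ∀ z ∈ A, ∀ x ∈ A, dist z x ≤ R := fun z hz x hx =>
      (Metric.dist_le_diam_of_mem hA.compact.isBounded hz hx).trans hD
    refine hn' fun x hx => ⟨_, IsSepFamily.cons (g := g) ⟨hg.mem, fun i => ?_, hg.sep⟩ hy
      (hball y hy x hx) hcon⟩
    exact hball _ (hg.mem i) x hx

end Homogeneous

section Tree

variable {X : Type*} {n : ℕ → ℕ}

/-- The level-`k` point of the tree with root `x₀` along the branch `ω`. -/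
def treePoint (child : ∀ k, X → Fin (n k) → X) (x₀ : X) (ω : SeqSpace n) : ℕ → X
  | 0 => x₀
  | k + 1 => child k (treePoint child x₀ ω k) (ω k)

lemma treePoint_congr (child : ∀ k, X → Fin (n k) → X) (x₀ : X) {ω η : SeqSpace n} {k : ℕ}
    (h : η ∈ seqCyl ω k) : treePoint child x₀ η k = treePoint child x₀ ω k := by
  induction k with
  | zero => rfl
  | succ k ih =>
    rw [treePoint, treePoint, ih fun i hi => h i (by omega), h k (by omega)]

variable [MetricSpace X]

/-- The limits along the branches of a tree of separated families form a coding. -/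
lemma exists_tree_coding {A : Set X} (hA : IsCompact A) {x₀ : X} (hx₀ : x₀ ∈ A) {D c : ℝ}
    (hD : 0 < D) (hc : 0 < c) (hc2 : c ≤ 1 / 4) (child : ∀ k, X → Fin (n k) → X)
    (hchild : ∀ k, ∀ x ∈ A, IsSepFamily A (D * c ^ (k + 1)) (D * c ^ k) x (child k x)) :
    ∃ π : SeqSpace n → X, (∀ ω, π ω ∈ A) ∧ IsCoding n c (D * c) (3 * D) π ∧
      ∀ ω, dist (child 0 x₀ (ω 0)) (π ω) ≤ 2 * D * c := by
  have hc1 : c < 1 := by linarith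
  have hmem : ∀ ω k, treePoint child x₀ ω k ∈ A := by
    intro ω k
    induction k with
    | zero => exact hx₀
    | succ k ih => exact (hchild k _ ih).mem _
  have hstep : ∀ ω k, dist (treePoint child x₀ ω k) (treePoint child x₀ ω (k + 1)) ≤
      D * c ^ k := by
    intro ω k
    rw [dist_comm]
    exact (hchild k _ (hmem ω k)).dist_le (ω k)
  have hlim : ∀ ω, ∃ y ∈ A, Tendsto (treePoint child x₀ ω) atTop (nhds y) := fun ω =>
    cauchySeq_tendsto_of_isComplete hA.isComplete (hmem ω)
      (cauchySeq_of_le_geometric c D hc1 (hstep ω))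
  choose π hπA hπ using hlim
  have hdist : ∀ ω k, dist (treePoint child x₀ ω k) (π ω) ≤ 4 / 3 * (D * c ^ k) := by
    intro ω k
    refine (dist_le_of_le_geometric_of_tendsto c D hc1 (hstep ω) (hπ ω) k).trans ?_
    have hp : 0 < D * c ^ k := by positivity
    rw [div_le_iff₀ (by linarith)]
    nlinarith
  refine ⟨π, hπA, ⟨fun ω η k h => ?_, fun ω η k h hne => ?_⟩, fun ω => ?_⟩
  · have h1 := hdist ω k
    have h2 := hdist η k
    rw [treePoint_congr child x₀ h] at h2
    have h3 := dist_triangle_left (π η) (π ω) (treePoint child x₀ ω k)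
    have hp : 0 < D * c ^ k := by positivity
    linarith
  · have h1 := hdist ω (k + 1)
    have h2 := hdist η (k + 1)
    have h4 := (hchild k _ (hmem ω k)).sep (η k) (ω k) hne
    rw [treePoint] at h1 h2
    rw [treePoint_congr child x₀ h] at h2
    have h3 := dist_triangle4_right (child k (treePoint child x₀ ω k) (η k))
      (child k (treePoint child x₀ ω k) (ω k)) (π η) (π ω)
    have hp : 0 < D * c ^ (k + 1) := by positivity
    have he : D * c * c ^ k = D * c ^ (k + 1) := by ring
    rw [he]
    linarith
  · have h1 := hdist ω 1
    rw [treePoint, treePoint, pow_one] at h1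
    have hp : 0 < D * c := by positivity
    linarith

end Tree

section Embedding

variable {X : Type*} [MetricSpace X] [MeasurableSpace X] {A : Set X} {μ : Measure X}
  {lam kappa del Del : ℝ}

lemma IsHomog.nat_mul_log_le_neg_log_ballMass (hA : IsHomog A μ lam kappa del Del) {x : X}
    (hx : x ∈ A) {r : ℝ} (hr : 0 < r) (j : ℕ) (hrj : r ≤ kappa ^ j * Metric.diam A) :
    j * Real.log del ≤ -Real.log (ballMass μ x r) := by
  have hk := hA.kappa_pos
  have h1 := hA.pow_mul_ballMass_le hx hA.diam_pos le_rfl j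
  have h2 := hA.ballMass_mono x hrj
  have h3 := hA.ballMass_pos hx hr
  have hd : 0 < del ^ j := pow_pos (by linarith [hA.one_lt_del]) j
  have h4 : del ^ j * ballMass μ x r ≤ 1 :=
    (mul_le_mul_of_nonneg_left h2 hd.le).trans (h1.trans (hA.ballMass_le_one x _))
  have h5 := Real.log_nonpos (mul_pos hd h3).le h4
  rw [Real.log_mul hd.ne' h3.ne', Real.log_pow] at h5
  linarith

lemma IsHomog.tendsto_log_ballMass (hA : IsHomog A μ lam kappa del Del) {x : X} (hx : x ∈ A) :
    Tendsto (fun r => Real.log (ballMass μ x r)) (nhdsWithin 0 (Set.Ioi 0)) atBot := by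
  rw [tendsto_atBot]
  intro B
  have hld : 0 < Real.log del := Real.log_pos hA.one_lt_del
  obtain ⟨j, hj⟩ := exists_nat_gt (-B / Real.log del)
  rw [div_lt_iff₀ hld] at hj
  have hpos : 0 < kappa ^ j * Metric.diam A := mul_pos (pow_pos hA.kappa_pos j) hA.diam_pos
  filter_upwards [Ioo_mem_nhdsGT hpos] with r hr
  linarith [hA.nat_mul_log_le_neg_log_ballMass hx hr.1 j hr.2.le]

/-- The mass of a ball of radius `r ∈ [b c ^ (k+1), b c ^ k]` is comparable to that of
a ball of radius `c ^ k * diam A`. -/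
lemma IsHomog.abs_log_ballMass_sub_le (hA : IsHomog A μ lam kappa del Del) {x₀ : X}
    (hx₀ : x₀ ∈ A) {b c : ℝ} {m : ℕ} (hc : c = kappa ^ m) (hb : Metric.diam A ≤ b) :
    ∃ K : ℝ, ∀ x ∈ A, ∀ (k : ℕ) (r : ℝ), b * c ^ (k + 1) ≤ r → r ≤ b * c ^ k →
      |Real.log (ballMass μ x₀ (Metric.diam A * c ^ k)) - Real.log (ballMass μ x r)| ≤ K := by
  have hD := hA.diam_pos
  have hb0 : 0 < b := hD.trans_le hb
  have hc0 : 0 < c := hc ▸ pow_pos hA.kappa_pos m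
  have hlam : 0 < lam := by linarith [hA.one_le_lam]
  have hDel : 0 < Del := by linarith [hA.Del_pos]
  have hlD : 0 ≤ Real.log Del := Real.log_nonneg hA.Del_pos.le
  obtain ⟨u, hu⟩ := exists_pow_lt_of_lt_one (div_pos hD hb0) hA.kappa_lt_one
  rw [lt_div_iff₀ hb0] at hu
  refine ⟨Real.log lam + (m + u) * Real.log Del, fun x hx k r h1 h2 => ?_⟩
  have hck : 0 < c ^ k := pow_pos hc0 k
  have hr : 0 < r := lt_of_lt_of_le (by positivity) h1
  have hMr := hA.ballMass_pos hx hr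
  have hMk := hA.ballMass_pos hx₀ (mul_pos hD hck)
  have hlo : ballMass μ x₀ (Metric.diam A * c ^ k) ≤ Del ^ m * (lam * ballMass μ x r) := by
    refine (hA.ballMass_le_pow_mul hx₀ (mul_pos hD hck) m).trans ?_
    gcongr Del ^ m * ?_
    refine (hA.ballMass_mono x₀ ?_).trans (hA.ballMass_le_mul hx₀ hx hr)
    calc kappa ^ m * (Metric.diam A * c ^ k) = Metric.diam A * c ^ (k + 1) := by
          rw [← hc]; ring
      _ ≤ b * c ^ (k + 1) := by gcongr
      _ ≤ r := h1
  have hhi : ballMass μ x r ≤ lam * (Del ^ u * ballMass μ x₀ (Metric.diam A * c ^ k)) := by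
    refine (hA.ballMass_le_mul hx hx₀ hr).trans ?_
    gcongr lam * ?_
    refine (hA.ballMass_le_pow_mul hx₀ hr u).trans ?_
    gcongr Del ^ u * ?_
    refine hA.ballMass_mono x₀ ?_
    calc kappa ^ u * r ≤ kappa ^ u * (b * c ^ k) := by
          have := hA.kappa_pos
          gcongr
      _ = kappa ^ u * b * c ^ k := by ring
      _ ≤ _ := by gcongr
  have hlo' := Real.log_le_log hMk hlo
  have hhi' := Real.log_le_log hMr hhi
  rw [Real.log_mul (by positivity) (by positivity), Real.log_mul hlam.ne' hMr.ne',
    Real.log_pow] at hlo'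
  rw [Real.log_mul hlam.ne' (by positivity), Real.log_mul (by positivity) hMk.ne',
    Real.log_pow] at hhi'
  have h3 : 0 ≤ (m : ℝ) * Real.log Del := by positivity
  have h4 : 0 ≤ (u : ℝ) * Real.log Del := by positivity
  rw [abs_le]
  constructor <;> linarith

lemma prodN_succ (n : ℕ → ℕ) (k : ℕ) : prodN n (k + 1) = prodN n k * n k :=
  Finset.prod_range_succ _ _

/-- If the branching numbers are comparable to the ratios of consecutive masses, then
their products are comparable to the inverse masses up to a factor `C ^ k`. -/
lemma abs_log_prodN_add_log_le {n : ℕ → ℕ} {M : ℕ → ℝ} {C : ℝ} (hC : 0 < C) (hn : ∀ k, 0 < n k)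
    (hM : ∀ k, 0 < M k) (hM0 : M 0 = 1) (h1 : ∀ k, M k ≤ C * (n k * M (k + 1)))
    (h2 : ∀ k, n k * M (k + 1) ≤ C * M k) (k : ℕ) :
    |Real.log (prodN n k) + Real.log (M k)| ≤ k * Real.log C := by
  induction k with
  | zero => simp [prodN, hM0]
  | succ k ih =>
    have hnk : (0 : ℝ) < n k := Nat.cast_pos.2 (hn k)
    have hP : (prodN n k : ℝ) ≠ 0 :=
      Nat.cast_ne_zero.2 (Finset.prod_pos fun i _ => hn i).ne'
    have h3 := Real.log_le_log (hM k) (h1 k)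
    have h4 := Real.log_le_log (mul_pos hnk (hM (k + 1))) (h2 k)
    rw [Real.log_mul hC.ne' (mul_pos hnk (hM (k + 1))).ne',
      Real.log_mul hnk.ne' (hM (k + 1)).ne'] at h3
    rw [Real.log_mul hC.ne' (hM k).ne', Real.log_mul hnk.ne' (hM (k + 1)).ne'] at h4
    rw [prodN_succ, Nat.cast_mul, Real.log_mul hP hnk.ne']
    rw [abs_le] at ih ⊢
    push_cast
    constructor <;> linarith [ih.1, ih.2]

/-- A homogeneous set contains arbitrarily dense coded subsets whose branching numbers
follow the mass distribution with arbitrarily small relative logarithmic error. -/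
lemma IsHomog.exists_coding [BorelSpace X] (hA : IsHomog A μ lam kappa del Del) {x₀ : X}
    (hx₀ : x₀ ∈ A) {ε θ : ℝ} (hε : 0 < ε) (hθ : 0 < θ) :
    ∃ (n : ℕ → ℕ) (N m : ℕ) (c a : ℝ) (π : SeqSpace n → X), c = kappa ^ m ∧ c ≤ 1 / 4 ∧ 0 < a ∧
      (∀ k, 2 ≤ n k) ∧ (∀ k, n k ≤ N) ∧ (∀ ω, π ω ∈ A) ∧
      IsCoding n c a (3 * Metric.diam A) π ∧ Metric.hausdorffDist (Set.range π) A < ε ∧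
      ∀ k, |Real.log (prodN n k) + Real.log (ballMass μ x₀ (Metric.diam A * c ^ k))| ≤
        θ * -Real.log (ballMass μ x₀ (Metric.diam A * c ^ k)) := by
  have hD := hA.diam_pos
  have hkap := hA.kappa_pos
  have hlam : 0 < lam := by linarith [hA.one_le_lam]
  have hDel : 0 < Del := by linarith [hA.Del_pos]
  have hld : 0 < Real.log del := Real.log_pos hA.one_lt_del
  obtain ⟨t, ht⟩ := exists_pow_lt_of_lt_one (by norm_num : (0 : ℝ) < 1 / 4) hA.kappa_lt_one
  set C := lam ^ 2 * Del ^ t with hCdef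
  have hC : 0 < C := by positivity
  obtain ⟨m, hm1, hm2, hm3, hm4⟩ : ∃ m : ℕ, kappa ^ m < 1 / 4 ∧
      kappa ^ m < ε / (6 * Metric.diam A) ∧ 2 * C ≤ del ^ m ∧
      Real.log C / (θ * Real.log del) ≤ m := by
    have hk := tendsto_pow_atTop_nhds_zero_of_lt_one hkap.le hA.kappa_lt_one
    exact ((hk.eventually (gt_mem_nhds (by norm_num))).and
      ((hk.eventually (gt_mem_nhds (by positivity))).and
      (((tendsto_pow_atTop_atTop_of_one_lt hA.one_lt_del).eventually_ge_atTop _).and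
      (tendsto_natCast_atTop_atTop.eventually_ge_atTop _)))).exists
  obtain ⟨c, hc⟩ : ∃ c, c = kappa ^ m := ⟨_, rfl⟩
  rw [← hc] at hm1 hm2
  have hc0 : 0 < c := hc ▸ pow_pos hkap m
  have hRpos : ∀ k, 0 < Metric.diam A * c ^ k := fun k => by positivity
  have hRle : ∀ k, Metric.diam A * c ^ (k + 1) ≤ Metric.diam A * c ^ k := fun k => by
    gcongr ?_ * ?_
    exact pow_le_pow_of_le_one hc0.le (by linarith) (by omega)
  have hRsucc : ∀ k, kappa ^ m * (Metric.diam A * c ^ k) = Metric.diam A * c ^ (k + 1) := by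
    intro k
    rw [← hc]; ring
  choose n hsep hlo hhi hnet using fun k =>
    hA.exists_branching ht.le (hRpos (k + 1)) (hRle k) hx₀
  rw [← hCdef] at hlo hhi
  have hMpos : ∀ k, 0 < ballMass μ x₀ (Metric.diam A * c ^ k) := fun k =>
    hA.ballMass_pos hx₀ (hRpos k)
  have hn2 : ∀ k, 2 ≤ n k := by
    intro k
    have h1 := hA.pow_mul_ballMass_le hx₀ (hRpos k)
      (mul_le_of_le_one_right hD.le (pow_le_one₀ hc0.le (by linarith))) m
    rw [hRsucc] at h1
    have h2 := (mul_le_mul_of_nonneg_right hm3 (hMpos (k + 1)).le).trans (h1.trans (hlo k))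
    have h3 : C * ballMass μ x₀ (Metric.diam A * c ^ (k + 1)) * 2 ≤
        C * ballMass μ x₀ (Metric.diam A * c ^ (k + 1)) * n k := by linarith
    exact_mod_cast le_of_mul_le_mul_left h3 (mul_pos hC (hMpos (k + 1)))
  have hnN : ∀ k, n k ≤ ⌊C * Del ^ m⌋₊ := by
    intro k
    refine Nat.le_floor ?_
    have h1 := hA.ballMass_le_pow_mul hx₀ (hRpos k) m
    rw [hRsucc] at h1
    refine le_of_mul_le_mul_right ?_ (hMpos (k + 1))
    calc _ ≤ C * ballMass μ x₀ (Metric.diam A * c ^ k) := hhi k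
      _ ≤ C * (Del ^ m * ballMass μ x₀ (Metric.diam A * c ^ (k + 1))) := by gcongr
      _ = _ := by ring
  have hchild : ∀ k x, ∃ g : Fin (n k) → X, x ∈ A →
      IsSepFamily A (Metric.diam A * c ^ (k + 1)) (Metric.diam A * c ^ k) x g := by
    intro k x
    by_cases hx : x ∈ A
    · obtain ⟨g, hg⟩ := hsep k x hx
      exact ⟨g, fun _ => hg⟩
    · exact ⟨fun _ => x, fun h => absurd h hx⟩
  choose child hchild using hchild
  obtain ⟨π, hπA, hπ, hπnet⟩ := exists_tree_coding hA.compact hx₀ hD hc0 hm1.le child hchild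
  refine ⟨n, _, m, c, _, π, hc, hm1.le, mul_pos hD hc0, hn2, hnN, hπA, hπ, ?_, fun k => ?_⟩
  · rw [lt_div_iff₀ (by positivity)] at hm2
    refine lt_of_le_of_lt (b := 6 * Metric.diam A * c) ?_ (by linarith)
    refine Metric.hausdorffDist_le_of_mem_dist (by positivity) ?_ fun y hy => ?_
    · rintro _ ⟨ω, rfl⟩
      exact ⟨π ω, hπA ω, by rw [dist_self]; positivity⟩
    · obtain ⟨i, hi⟩ := hnet 0 (by simp) _ (hchild 0 x₀ hx₀) y hy
      let ω : SeqSpace n :=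
        Function.update (fun k => ⟨0, lt_of_lt_of_le two_pos (hn2 k)⟩) 0 i
      refine ⟨π ω, Set.mem_range_self _, ?_⟩
      have h1 := hπnet ω
      simp only [ω, Function.update_self] at h1
      have h2 := dist_triangle_left y (π ω) (child 0 x₀ i)
      rw [zero_add, pow_one] at hi
      linarith
  · have hM0 : ballMass μ x₀ (Metric.diam A * c ^ 0) = 1 :=
      hA.ballMass_eq_one hx₀ (by simp)
    refine (abs_log_prodN_add_log_le hC (fun k => lt_of_lt_of_le two_pos (hn2 k)) hMpos hM0
      hlo hhi k).trans ?_
    have h1 := hA.nat_mul_log_le_neg_log_ballMass hx₀ (hRpos k) (m * k)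
      (by rw [hc, ← pow_mul, mul_comm])
    rw [div_le_iff₀ (by positivity)] at hm4
    calc (k : ℝ) * Real.log C ≤ k * (m * (θ * Real.log del)) := by gcongr
      _ = θ * ((m * k : ℕ) * Real.log del) := by push_cast; ring
      _ ≤ _ := by gcongr

end Embedding

section Comparison

variable {ι : Type*} {l : Filter ι}

lemma limsup_le_limsup_of_forall_le_add [NeBot l] {f g : ι → ℝ} (hf : ∀ i, 0 ≤ f i)
    (hg : ∀ i, 0 ≤ g i) (hbdd : l.IsBoundedUnder (· ≤ ·) g)
    (h : ∀ θ : ℝ, 0 < θ → ∀ᶠ i in l, f i ≤ g i + θ) : limsup f l ≤ limsup g l := by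
  have hcob : ∀ {u : ι → ℝ}, (∀ i, 0 ≤ u i) → l.IsCoboundedUnder (· ≤ ·) u := fun hu =>
    (isBoundedUnder_of_eventually_ge (Eventually.of_forall hu)).isCobounded_le
  refine le_of_forall_pos_le_add fun θ hθ => ?_
  rw [← limsup_add_const l g θ hbdd (hcob hg)]
  refine limsup_le_limsup (h θ hθ) (hcob hf) ?_
  obtain ⟨B, hB⟩ := hbdd.eventually_le
  exact isBoundedUnder_of_eventually_le (a := B + θ) (hB.mono fun i hi => by linarith)

/-- If `u = v + O(1)` up to a relative error `η` and `v → -∞`, then `log (u / v)` is eventually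
at most `4 η` in absolute value. -/
lemma eventually_abs_log_div_le {u v : ι → ℝ} {K η : ℝ} (hv : Tendsto v l atBot) (hη : 0 < η)
    (hη' : η ≤ 1 / 8) (h : ∀ᶠ i in l, |u i - v i| ≤ K + η * |v i|) :
    ∀ᶠ i in l, |Real.log (u i / v i)| ≤ 4 * η := by
  filter_upwards [h, hv.eventually_le_atBot (-(K / η)), hv.eventually_lt_atBot 0]
    with i hi hvK hv0
  have hK : K ≤ η * |v i| := by
    rw [abs_of_neg hv0]
    have := mul_le_mul_of_nonneg_left hvK hη.le
    rw [mul_neg, mul_div_cancel₀ _ hη.ne'] at this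
    linarith
  have hdiv : |u i / v i - 1| ≤ 2 * η := by
    rw [div_sub_one hv0.ne, abs_div, div_le_iff₀ (abs_pos.2 hv0.ne)]
    linarith
  obtain ⟨h1, h2⟩ := abs_le.1 hdiv
  have hpos : 0 < u i / v i := by linarith
  have h3 := Real.log_le_sub_one_of_pos hpos
  have h4 := Real.one_sub_inv_le_log_of_pos hpos
  have h5 : (u i / v i)⁻¹ ≤ 1 + 4 * η := by
    rw [inv_le_iff_one_le_mul₀ hpos]
    nlinarith
  exact abs_le.2 ⟨by linarith, by linarith⟩

lemma limsup_abs_log_div [NeBot l] {u v w : ι → ℝ} {K K' η : ℝ} (hv : Tendsto v l atBot)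
    (hη : 0 < η) (hη' : η ≤ 1 / 8) (huv : ∀ᶠ i in l, |u i - v i| ≤ K + η * |v i|)
    (hwu : ∀ᶠ i in l, |w i - u i| ≤ K') :
    limsup (fun i => |Real.log (u i / v i)|) l ≤ 4 * η ∧
      limsup (fun i => |Real.log (w i / v i)|) l = limsup (fun i => |Real.log (u i / v i)|) l := by
  have hle := eventually_abs_log_div_le hv hη hη' huv
  have hu : Tendsto u l atBot := by
    refine tendsto_atBot_mono' l (f₁ := fun i => v i / 2 + K) ?_
      (tendsto_atBot_add_const_right _ _ (hv.atBot_div_const two_pos))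
    filter_upwards [huv, hv.eventually_lt_atBot 0] with i hi hv0
    rw [abs_of_neg hv0] at hi
    nlinarith [(abs_le.1 hi).2]
  have hw : Tendsto w l atBot := by
    refine tendsto_atBot_mono' l (f₁ := fun i => u i + K') ?_
      (tendsto_atBot_add_const_right _ _ hu)
    filter_upwards [hwu] with i hi
    linarith [(abs_le.1 hi).2]
  have hdiff : ∀ θ : ℝ, 0 < θ → ∀ᶠ i in l,
      |(|Real.log (w i / v i)| - |Real.log (u i / v i)|)| ≤ θ := by
    intro θ hθ
    have hθ' : 0 < min (θ / 4) (1 / 8) := by positivity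
    filter_upwards [eventually_abs_log_div_le (K := K') hu hθ' (min_le_right _ _)
      (hwu.mono fun i hi => hi.trans (by nlinarith [abs_nonneg (u i)])),
      hv.eventually_lt_atBot 0, hu.eventually_lt_atBot 0, hw.eventually_lt_atBot 0]
      with i hi hv0 hu0 hw0
    refine (abs_abs_sub_abs_le_abs_sub _ _).trans ?_
    rw [← Real.log_div (div_ne_zero hw0.ne hv0.ne) (div_ne_zero hu0.ne hv0.ne),
      div_div_div_cancel_right₀ hv0.ne]
    linarith [min_le_left (θ / 4) (1 / 8)]
  have hbu := isBoundedUnder_of_eventually_le hle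
  have hbw : l.IsBoundedUnder (· ≤ ·) fun i => |Real.log (w i / v i)| :=
    isBoundedUnder_of_eventually_le (a := 4 * η + 1) <| by
      filter_upwards [hle, hdiff 1 one_pos] with i h1 h2
      linarith [(abs_le.1 h2).2]
  refine ⟨limsup_le_of_le (isBoundedUnder_of_eventually_ge
    (Eventually.of_forall fun i => abs_nonneg _)).isCobounded_le hle, le_antisymm ?_ ?_⟩
  · refine limsup_le_limsup_of_forall_le_add (fun i => abs_nonneg _) (fun i => abs_nonneg _) hbu
      fun θ hθ => (hdiff θ hθ).mono fun i hi => ?_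
    linarith [(abs_le.1 hi).2]
  · refine limsup_le_limsup_of_forall_le_add (fun i => abs_nonneg _) (fun i => abs_nonneg _) hbw
      fun θ hθ => (hdiff θ hθ).mono fun i hi => ?_
    linarith [(abs_le.1 hi).1]

lemma IsAlphaRep.exists_log_ballMass {X : Type*} [MetricSpace X] [MeasurableSpace X]
    {A : Set X} {μ : Measure X} {g : ℝ → ℝ} (h : IsAlphaRep A μ g) :
    ∃ x ∈ A, ∃ C : ℝ, ∀ᶠ r in nhdsWithin 0 (Set.Ioi 0),
      |Real.log (ballMass μ x r) - g r * Real.log r| ≤ C := by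
  obtain ⟨x, hx, C, -, δ, hδ, h⟩ := h
  refine ⟨x, hx, C, ?_⟩
  filter_upwards [Ioo_mem_nhdsGT hδ, Ioo_mem_nhdsGT one_pos] with r hr hr1
  have hlog : Real.log r ≠ 0 := (Real.log_neg hr1.1 hr1.2).ne
  have h1 := h r hr.1 hr.2
  simp only [alphaPt] at h1
  rw [le_div_iff₀ (abs_pos.2 hlog), ← abs_mul, sub_mul, div_mul_cancel₀ _ hlog] at h1
  exact h1

lemma chiFun_eq_limsup (g h : ℝ → ℝ) :
    chiFun g h = limsup (fun r => |Real.log (g r * Real.log r / (h r * Real.log r))|)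
      (nhdsWithin 0 (Set.Ioi 0)) := by
  refine limsup_congr ?_
  filter_upwards [Ioo_mem_nhdsGT one_pos] with r hr
  rw [mul_div_mul_right _ _ (Real.log_neg hr.1 hr.2).ne]

end Comparison

/-- Approximation theorem: for a homogeneous set `A` and any `ε > 0` there are a Moran set
`E` in a Euclidean space and a bilipschitz map `f` from `E` into `A` with
`d_H(f(E),A) < ε` and `χ(E,A) = χ(f(E),A) < ε`. -/
theorem statement10 {X : Type*} [MetricSpace X] [MeasurableSpace X] [BorelSpace X]
    (A : Set X) (μ : Measure X) (lam kappa del Del : ℝ)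
    (hA : IsHomog A μ lam kappa del Del) (ε : ℝ) (hε : 0 < ε) :
    ∃ (d : ℕ) (J : Set (EuclideanSpace ℝ (Fin d))) (n : ℕ → ℕ) (c : ℕ → ℝ)
      (Jw : List ℕ → Set (EuclideanSpace ℝ (Fin d))),
      IsMoranSystem J n c Jw ∧
      ∃ (f : EuclideanSpace ℝ (Fin d) → X) (L : ℝ), 1 ≤ L ∧
        Set.MapsTo f (moranSet n Jw) A ∧
        (∀ x₁ ∈ moranSet n Jw, ∀ x₂ ∈ moranSet n Jw,
          dist x₁ x₂ / L ≤ dist (f x₁) (f x₂) ∧ dist (f x₁) (f x₂) ≤ L * dist x₁ x₂) ∧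
        Metric.hausdorffDist (f '' moranSet n Jw) A < ε ∧
        ∃ (μE : Measure (EuclideanSpace ℝ (Fin d))) (lam₁ kappa₁ del₁ Del₁ : ℝ),
          IsHomog (moranSet n Jw) μE lam₁ kappa₁ del₁ Del₁ ∧
          ∃ (νF : Measure X) (lam₂ kappa₂ del₂ Del₂ : ℝ),
            IsHomog (f '' moranSet n Jw) νF lam₂ kappa₂ del₂ Del₂ ∧
            ∀ gE gF gA : ℝ → ℝ, IsAlphaRep (moranSet n Jw) μE gE →
              IsAlphaRep (f '' moranSet n Jw) νF gF → IsAlphaRep A μ gA →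
              chiFun gE gA < ε ∧ chiFun gF gA = chiFun gE gA := by
  obtain ⟨x₀, hx₀⟩ : A.Nonempty := by
    rw [Set.nonempty_iff_ne_empty]
    rintro rfl
    simpa using hA.diam_pos
  have hD := hA.diam_pos
  set θ := min (1 / 8) (ε / 8)
  have hθ0 : 0 < θ := by positivity
  obtain ⟨n, N, m, c, a, π, hc, hc4, ha, h2, hN, hπA, hπ, hHd, hlogP⟩ :=
    hA.exists_coding hx₀ hε hθ0
  have hc0 : 0 < c := hc ▸ pow_pos hA.kappa_pos m
  have hc1 : c < 1 := by linarith
  have hNd : ∀ k, n k ≤ 2 ^ N := fun k => (hN k).trans Nat.lt_two_pow_self.le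
  have : ∀ k, NeZero (n k) := fun k => ⟨by have := h2 k; omega⟩
  let σ : SeqSpace n → EuclideanSpace ℝ (Fin N) := fun ω => cubePoint N c fun i => ω i
  set b := max √N (3 * Metric.diam A)
  have hDb : 3 * Metric.diam A ≤ b := le_max_right _ _
  have hb0 : 0 < b := by linarith
  have ha' : 0 < min (1 / 2) a := lt_min (by norm_num) ha
  replace hπ : IsCoding n c (min (1 / 2) a) b π := hπ.mono hc0 (min_le_right _ _) hDb
  have hσ : IsCoding n c (min (1 / 2) a) b σ :=
    (isCoding_cubePoint hc0 hc4 hNd).mono hc0 (min_le_left _ _) (le_max_left _ _)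
  have hE : moranSet n (wordCube N c) = Set.range σ := moranSet_wordCube hc0 hc4 h2 hNd
  let f : EuclideanSpace ℝ (Fin N) → X := Function.extend σ π fun _ => x₀
  have hfσ : ∀ ω, f (σ ω) = π ω := (hσ.injective hc0 ha').extend_apply π _
  have hF : f '' Set.range σ = Set.range π := by
    rw [← Set.range_comp]
    exact congrArg Set.range (funext hfσ)
  refine ⟨N, _, n, fun _ => c, wordCube N c, isMoranSystem_wordCube hc0 hc4 h2 hNd, f,
    max 1 (b / min (1 / 2) a), le_max_left _ _, ?_⟩
  rw [hE, hF]
  refine ⟨?_, ?_, hHd, ?_⟩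
  · rintro _ ⟨ω, rfl⟩
    exact hfσ ω ▸ hπA ω
  · rintro _ ⟨ω, rfl⟩ _ ⟨η, rfl⟩
    rw [hfσ, hfσ]
    constructor
    · rw [div_le_iff₀' (by positivity)]
      refine (hπ.bilipschitz hσ ha' hb0.le ω η).trans ?_
      gcongr
      exact le_max_right _ _
    · refine (hσ.bilipschitz hπ ha' hb0.le ω η).trans ?_
      gcongr
      exact le_max_right _ _
  obtain ⟨lam₁, kappa₁, del₁, Del₁, hE'⟩ := hσ.isHomog hc0 hc1 ha' hb0 h2 hN
  obtain ⟨lam₂, kappa₂, del₂, Del₂, hF'⟩ := hπ.isHomog hc0 hc1 ha' hb0 h2 hN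
  refine ⟨_, lam₁, kappa₁, del₁, Del₁, hE', _, lam₂, kappa₂, del₂, Del₂, hF',
    fun gE gF gA hgE hgF hgA => ?_⟩
  obtain ⟨_, ⟨ω, rfl⟩, CE, hCE⟩ := hgE.exists_log_ballMass
  obtain ⟨_, ⟨η, rfl⟩, CF, hCF⟩ := hgF.exists_log_ballMass
  obtain ⟨x, hx, CA, hCA⟩ := hgA.exists_log_ballMass
  obtain ⟨KE, hKE⟩ := hσ.abs_log_measure_add_le hc0 hc1 ha' hb0 hN
  obtain ⟨KF, hKF⟩ := hπ.abs_log_measure_add_le hc0 hc1 ha' hb0 hN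
  obtain ⟨KA, hKA⟩ := hA.abs_log_ballMass_sub_le hx₀ hc (b := b) (by linarith)
  have hgA' : Tendsto (fun r => gA r * Real.log r) (nhdsWithin 0 (Set.Ioi 0)) atBot := by
    refine tendsto_atBot_mono' _ (f₁ := fun r => Real.log (ballMass μ x r) + CA) ?_
      (tendsto_atBot_add_const_right _ _ (hA.tendsto_log_ballMass hx))
    filter_upwards [hCA] with r hr
    linarith [(abs_le.1 hr).1]
  have hlevel : ∀ᶠ r in nhdsWithin (0 : ℝ) (Set.Ioi 0),
      ∃ k : ℕ, b * c ^ (k + 1) ≤ r ∧ r ≤ b * c ^ k := by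
    filter_upwards [Ioo_mem_nhdsGT hb0] with r hr
    exact exists_level hb0 hc0 hc1 hr.1 hr.2.le
  have hEA : ∀ᶠ r in nhdsWithin (0 : ℝ) (Set.Ioi 0),
      |gE r * Real.log r - gA r * Real.log r| ≤
        (CE + KE + (1 + θ) * (KA + CA)) + θ * |gA r * Real.log r| := by
    filter_upwards [hCE, hCA, hlevel] with r h1 h3 ⟨k, hk1, hk2⟩
    have h4 := hKE ω k r hk1 hk2
    have h5 := hKA x hx k r hk1 hk2
    have h6 := hlogP k
    have h7 := mul_le_mul_of_nonneg_left (show -Real.log (ballMass μ x₀ (Metric.diam A * c ^ k)) ≤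
      |gA r * Real.log r| + (KA + CA) by
        linarith [(abs_le.1 h3).1, (abs_le.1 h5).1, neg_abs_le (gA r * Real.log r)]) hθ0.le
    simp only [ballMass] at h1 h3 h5 h6 h7
    generalize |gA r * Real.log r| = t at *
    rw [abs_le] at *
    constructor <;> linarith
  have hFE : ∀ᶠ r in nhdsWithin (0 : ℝ) (Set.Ioi 0),
      |gF r * Real.log r - gE r * Real.log r| ≤ CE + CF + KE + KF := by
    filter_upwards [hCE, hCF, hlevel] with r h1 h3 ⟨k, hk1, hk2⟩
    have h4 := hKE ω k r hk1 hk2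
    have h5 := hKF η k r hk1 hk2
    simp only [ballMass] at h1 h3
    rw [abs_le] at *
    constructor <;> linarith
  rw [chiFun_eq_limsup, chiFun_eq_limsup]
  obtain ⟨h1, h3⟩ := limsup_abs_log_div hgA' hθ0 (min_le_left _ _) hEA hFE
  exact ⟨h1.trans_lt (by linarith [min_le_right (1 / 8) (ε / 8)]), h3⟩

end
end
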